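/- For every integer ℓ ≥ 3 there exists a skewness-1 simple graph G with exactly n = 11ℓ − 4 vertices such that cr_{skew-1}(G) ≥ ℓ and cr(G) ≤ 3; moreover the skewness-1 crossing ratio is Θ(n). -/

import Mathlib

open Set

noncomputable section

/-- A drawing of a simple graph in the plane: vertices are mapped to distinct
points, each edge `uv` is drawn as a simple arc joining the images of `u` and
`v` and avoiding the images of the other vertices, any two arcs meet in
finitely many points, and no three arcs pass through a common non-vertex
point. -/
structure Drawing {V : Type} (G : SimpleGraph V) where
  vpos : V → ℝ × ℝ
  vpos_inj : Function.Injective vpos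
  arc : V → V → ℝ → ℝ × ℝ
  arc_symm : ∀ u v t, arc u v t = arc v u (1 - t)
  arc_cont : ∀ u v, G.Adj u v → ContinuousOn (arc u v) (Set.Icc 0 1)
  arc_injOn : ∀ u v, G.Adj u v → Set.InjOn (arc u v) (Set.Icc 0 1)
  arc_start : ∀ u v, G.Adj u v → arc u v 0 = vpos u
  arc_end : ∀ u v, G.Adj u v → arc u v 1 = vpos v
  arc_avoids : ∀ u v, G.Adj u v → ∀ t ∈ Set.Ioo (0:ℝ) 1, arc u v t ∉ Set.range vpos
  inter_finite : ∀ u v w z, G.Adj u v → G.Adj w z → s(u, v) ≠ s(w, z) →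
    ((arc u v '' Set.Icc 0 1) ∩ (arc w z '' Set.Icc 0 1)).Finite
  no_triple_point : ∀ p : ℝ × ℝ, p ∉ Set.range vpos →
    ∀ u₁ v₁ u₂ v₂ u₃ v₃, G.Adj u₁ v₁ → G.Adj u₂ v₂ → G.Adj u₃ v₃ →
      s(u₁, v₁) ≠ s(u₂, v₂) → s(u₁, v₁) ≠ s(u₃, v₃) → s(u₂, v₂) ≠ s(u₃, v₃) →
      ¬ (p ∈ arc u₁ v₁ '' Set.Icc 0 1 ∧ p ∈ arc u₂ v₂ '' Set.Icc 0 1 ∧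
          p ∈ arc u₃ v₃ '' Set.Icc 0 1)

namespace Drawing

variable {V : Type} {G : SimpleGraph V}

lemma img_symm_aux (Γ : Drawing G) (u v : V) :
    Γ.arc u v '' Set.Icc 0 1 = Γ.arc v u '' Set.Icc 0 1 := by
  have key : ∀ a b : V, Γ.arc a b '' Set.Icc 0 1 ⊆ Γ.arc b a '' Set.Icc 0 1 := by
    rintro a b p ⟨t, ht, rfl⟩
    refine ⟨1 - t, ⟨by linarith [ht.2], by linarith [ht.1]⟩, ?_⟩
    rw [Γ.arc_symm b a (1 - t)]
    congr 1
    ring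
  exact Set.Subset.antisymm (key u v) (key v u)

/-- The image (trace) of an edge in the drawing. -/
def img (Γ : Drawing G) (e : Sym2 V) : Set (ℝ × ℝ) :=
  Sym2.lift ⟨fun u v => Γ.arc u v '' Set.Icc 0 1, fun u v => Γ.img_symm_aux u v⟩ e

/-- `p` is a crossing point of the two distinct edges `e` and `f` : it lies on
both arcs and is not the image of a vertex (so it is not a shared endpoint). -/
def Crossing (Γ : Drawing G) (e f : Sym2 V) (p : ℝ × ℝ) : Prop :=
  e ∈ G.edgeSet ∧ f ∈ G.edgeSet ∧ e ≠ f ∧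
    p ∈ Γ.img e ∧ p ∈ Γ.img f ∧ p ∉ Set.range Γ.vpos

/-- The edges `e` and `f` cross in the drawing. -/
def Crosses (Γ : Drawing G) (e f : Sym2 V) : Prop := ∃ p, Γ.Crossing e f p

/-- The set of crossing points of a drawing. -/
def crossingSet (Γ : Drawing G) : Set (ℝ × ℝ) := {p | ∃ e f, Γ.Crossing e f p}

/-- The number of crossings of a drawing. -/
def crossings (Γ : Drawing G) : ℕ := Γ.crossingSet.ncard

/-- The set of crossing points lying on a given edge. -/
def edgeCrossings (Γ : Drawing G) (e : Sym2 V) : Set (ℝ × ℝ) :=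
  {p | ∃ f, Γ.Crossing e f p}

/-- A drawing is `k`-planar if every edge is involved in at most `k` crossings. -/
def IsKPlanar (Γ : Drawing G) (k : ℕ) : Prop :=
  ∀ e ∈ G.edgeSet, (Γ.edgeCrossings e).ncard ≤ k

/-- A drawing is `k`-gap-planar if each crossing can be assigned to one of its
two involved edges such that every edge is assigned at most `k` crossings. -/
def IsKGapPlanar (Γ : Drawing G) (k : ℕ) : Prop :=
  ∃ assign : ℝ × ℝ → Sym2 V,
    (∀ p ∈ Γ.crossingSet, ∃ f, Γ.Crossing (assign p) f p) ∧
    ∀ e : Sym2 V, {p | p ∈ Γ.crossingSet ∧ assign p = e}.ncard ≤ k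

/-- A drawing is skewness-`k` if there is a set of at most `k` edges such that
every crossing involves an edge from the set. -/
def IsSkewness (Γ : Drawing G) (k : ℕ) : Prop :=
  ∃ S : Finset (Sym2 V), S.card ≤ k ∧
    ∀ p ∈ Γ.crossingSet, ∃ e ∈ S, ∃ f, Γ.Crossing e f p

/-- A drawing is `k`-apex if there is a set of at most `k` vertices such that
every crossing involves an edge incident to one of these vertices. -/
def IsKApex (Γ : Drawing G) (k : ℕ) : Prop :=
  ∃ S : Finset V, S.card ≤ k ∧
    ∀ p ∈ Γ.crossingSet, ∃ e f, Γ.Crossing e f p ∧ ∃ a ∈ S, a ∈ e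

/-- A drawing is `(k,l)`-grid-free if there is no set of `k` edges each of
which crosses each edge of some set of `l` edges. -/
def IsGridFree (Γ : Drawing G) (k l : ℕ) : Prop :=
  ¬ ∃ A B : Finset (Sym2 V), A.card = k ∧ B.card = l ∧
      ∀ e ∈ A, ∀ f ∈ B, Γ.Crosses e f

/-- A drawing is `k`-fan-crossing-free if no edge crosses `k` edges that all
share a common endpoint. -/
def IsKFanCrossingFree (Γ : Drawing G) (k : ℕ) : Prop :=
  ¬ ∃ (e : Sym2 V) (a : V) (F : Finset (Sym2 V)), F.card = k ∧
      ∀ f ∈ F, a ∈ f ∧ Γ.Crosses e f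

/-- A drawing is planarly connected if for any two crossing edges, two of
their endpoints are joined by a crossing-free edge. -/
def IsPlanarlyConnected (Γ : Drawing G) : Prop :=
  ∀ e f : Sym2 V, Γ.Crosses e f →
    ∃ a b : V, a ∈ e ∧ b ∈ f ∧ G.Adj a b ∧ Γ.edgeCrossings s(a, b) = ∅

/-- A drawing is straight-line if every edge is drawn as the line segment
between the images of its endpoints. -/
def IsStraight (Γ : Drawing G) : Prop :=
  ∀ u v : V, G.Adj u v → ∀ t ∈ Set.Icc (0:ℝ) 1,
    Γ.arc u v t = (1 - t) • Γ.vpos u + t • Γ.vpos v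

/-- A straight-line RAC drawing: straight-line and any two crossing edges are
perpendicular. -/
def IsRAC (Γ : Drawing G) : Prop :=
  Γ.IsStraight ∧
    ∀ u v w z : V, G.Adj u v → G.Adj w z → Γ.Crosses s(u, v) s(w, z) →
      (Γ.vpos v - Γ.vpos u).1 * (Γ.vpos z - Γ.vpos w).1 +
        (Γ.vpos v - Γ.vpos u).2 * (Γ.vpos z - Γ.vpos w).2 = 0

end Drawing

/-- The crossing number of `G`: the minimum number of crossings over all
drawings of `G`. -/
def crNum {V : Type} (G : SimpleGraph V) : ℕ :=
  sInf {n | ∃ Γ : Drawing G, Γ.crossings = n}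

/-- The crossing number of `G` restricted to drawings satisfying `P`. -/
def crNumRestricted {V : Type} (G : SimpleGraph V) (P : Drawing G → Prop) : ℕ :=
  sInf {n | ∃ Γ : Drawing G, P Γ ∧ Γ.crossings = n}

/-- The rectilinear crossing number of `G`. -/
def rectCrNum {V : Type} (G : SimpleGraph V) : ℕ :=
  crNumRestricted G (fun Γ => Γ.IsStraight)

/-- An ℓ₂-bundle between `x` and `y`: `P` is the set of the internal vertices
of ℓ internally disjoint paths of length two from `x` to `y`, all of whose
internal vertices have degree exactly two in `G` (here ℓ = `P.card`). -/
def IsL2Bundle {V : Type} (G : SimpleGraph V) (x y : V) (P : Finset V) : Prop :=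
  x ≠ y ∧ x ∉ P ∧ y ∉ P ∧
    ∀ p ∈ P, G.Adj x p ∧ G.Adj p y ∧ (G.neighborSet p).ncard = 2

/-- Two drawings of `G` are weakly isomorphic: there is an incidence-preserving
one-to-one correspondence of vertices and edges that preserves crossings. -/
def WeaklyIso {V : Type} {G : SimpleGraph V} (Γ Γ' : Drawing G) : Prop :=
  ∃ φ : G ≃g G, ∀ e f : Sym2 V,
    Γ.Crosses e f ↔ Γ'.Crosses (Sym2.map (fun a => φ a) e) (Sym2.map (fun a => φ a) f)

/-- The complex number with the given coordinates. -/
def toC (p : ℝ × ℝ) : ℂ := ⟨p.1, p.2⟩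

lemma toC_injective : Function.Injective toC := by
  intro p q h
  simp only [toC, Complex.mk.injEq] at h
  exact Prod.ext h.1 h.2

lemma continuous_toC : Continuous toC :=
  Complex.equivRealProdCLM.symm.continuous

lemma toC_sub_ne_zero {p q : ℝ × ℝ} (h : p ≠ q) : toC p - toC q ≠ 0 :=
  sub_ne_zero.2 fun h' => h (toC_injective h')

lemma exists_continuous_log {A : Type*} [TopologicalSpace A] [SimplyConnectedSpace A]
    [LocallyPathConnectedSpace A] {f : A → ℂ} (hf : Continuous f) (h0 : ∀ x, f x ≠ 0) :
    ∃ g : A → ℂ, Continuous g ∧ ∀ x, Complex.exp (g x) = f x := by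
  have a₀ : A := Classical.arbitrary A
  obtain ⟨F, ⟨-, hF⟩, -⟩ := Complex.isCoveringMapOn_exp.existsUnique_continuousMap_lifts
    ⟨f, hf⟩ (a₀ := a₀) (Complex.exp_log (h0 a₀)) (fun x => h0 x)
  exact ⟨F, F.continuous, fun x => congrFun hF x⟩

/-- A continuous function with values in the kernel of `exp` on a preconnected space is
constant. -/
lemma eq_of_exp_eq_one {A : Type*} [TopologicalSpace A] {s : Set A} (hs : IsPreconnected s)
    {g : A → ℂ} (hg : ContinuousOn g s) (h1 : ∀ x ∈ s, Complex.exp (g x) = 1) {x y : A}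
    (hx : x ∈ s) (hy : y ∈ s) : g x = g y := by
  have hc : {z : ℂ | Complex.exp z = 1}.Countable := by
    refine (countable_range fun n : ℤ => (n * (2 * Real.pi * Complex.I) : ℂ)).mono ?_
    intro z hz
    obtain ⟨n, hn⟩ := Complex.exp_eq_one_iff.1 hz
    exact ⟨n, hn.symm⟩
  have hsub : g '' s ⊆ {z : ℂ | Complex.exp z = 1} := by
    rintro _ ⟨x, hx, rfl⟩
    exact h1 x hx
  exact hc.isTotallyDisconnected _ hsub (hs.image _ hg) (mem_image_of_mem _ hx)
    (mem_image_of_mem _ hy)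

lemma not_exists_extension_zpow (c : ℝ × ℝ) {m : ℤ} (hm : m ≠ 0) (R : ℝ) {h : ℝ × ℝ → ℂ}
    (hc : Continuous h) (h0 : ∀ p, h p ≠ 0)
    (hR : ∀ p, R ≤ ‖toC p - toC c‖ → h p = (toC p - toC c) ^ m) : False := by
  obtain ⟨g, hg, hgh⟩ := exists_continuous_log hc h0
  set r : ℝ := max R 1 with hr
  have hrpos : 0 < r := lt_of_lt_of_le one_pos (le_max_right _ _)
  let circ : ℝ → ℝ × ℝ := fun θ => (c.1 + r * Real.cos θ, c.2 + r * Real.sin θ)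
  have hcirc : Continuous circ := by fun_prop
  have hval : ∀ θ : ℝ, toC (circ θ) - toC c = Complex.exp (Real.log r + θ * Complex.I) := by
    intro θ
    rw [Complex.exp_add, ← Complex.ofReal_exp, Real.exp_log hrpos, Complex.exp_mul_I]
    apply Complex.ext <;> simp [toC, circ, Complex.cos_ofReal_re, Complex.sin_ofReal_re,
      Complex.cos_ofReal_im, Complex.sin_ofReal_im]
  have hnorm : ∀ θ : ℝ, R ≤ ‖toC (circ θ) - toC c‖ := by
    intro θ
    have hre : (Real.log r + θ * Complex.I : ℂ).re = Real.log r := by simp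
    rw [hval, Complex.norm_exp, hre, Real.exp_log hrpos]
    exact le_max_left _ _
  let φ : ℝ → ℂ := fun θ => g (circ θ) - m * (Real.log r + θ * Complex.I)
  have hφ : Continuous φ := by
    have := hg.comp hcirc
    fun_prop
  have h1 : ∀ θ, Complex.exp (φ θ) = 1 := by
    intro θ
    simp only [φ]
    rw [Complex.exp_sub, hgh, hR _ (hnorm θ), hval, ← Complex.exp_int_mul]
    exact div_self (Complex.exp_ne_zero _)
  have := eq_of_exp_eq_one isPreconnected_univ hφ.continuousOn (fun θ _ => h1 θ)
    (mem_univ 0) (mem_univ (2 * Real.pi))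
  have hcc : circ (2 * Real.pi) = circ 0 := by simp [circ]
  simp only [φ, hcc] at this
  have hz : (m : ℂ) * (2 * Real.pi * Complex.I) = 0 := by
    push_cast at this
    linear_combination this
  simp [hm, Real.pi_ne_zero] at hz

lemma toC_sub_zpow_continuousOn (a : ℝ × ℝ) (m : ℤ) {s : Set (ℝ × ℝ)} (ha : a ∉ s) :
    ContinuousOn (fun p => (toC p - toC a) ^ m) s := by
  refine ContinuousOn.zpow₀ (by have := continuous_toC; fun_prop) m fun p hp => Or.inl ?_
  exact toC_sub_ne_zero fun h => ha (h ▸ hp)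

lemma frontier_connectedComponentIn_subset {K : Set (ℝ × ℝ)} (hK : IsClosed K) (a : ℝ × ℝ) :
    frontier (connectedComponentIn Kᶜ a) ⊆ K := by
  intro p hp
  by_contra hpK
  have hU : IsOpen (connectedComponentIn Kᶜ a) := hK.isOpen_compl.connectedComponentIn
  have hV : IsOpen (connectedComponentIn Kᶜ p) := hK.isOpen_compl.connectedComponentIn
  have hpV : p ∈ connectedComponentIn Kᶜ p := mem_connectedComponentIn hpK
  obtain ⟨q, hqV, hqU⟩ := mem_closure_iff.1 hp.1 _ hV hpV
  have e1 := connectedComponentIn_eq hqV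
  have e2 := connectedComponentIn_eq hqU
  apply hp.2
  rw [hU.interior_eq, e2, ← e1]
  exact hpV

/-- Borsuk's obstruction to logarithms: if the component of `a` in the complement of the compact
set `K` is bounded and contains neither `b` nor `c`, then
`(z - a) ^ m * (z - b) ^ n * (z - c) ^ k` has no logarithm on `K` unless `m = 0`. -/
lemma no_log_of_bounded_component {K : Set (ℝ × ℝ)} (hK : IsClosed K) {a b c : ℝ × ℝ}
    (ha : a ∉ K) (hb : b ∉ K) (hc : c ∉ K)
    (hU : Bornology.IsBounded (connectedComponentIn Kᶜ a))
    (hbU : b ∉ connectedComponentIn Kᶜ a) (hcU : c ∉ connectedComponentIn Kᶜ a)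
    {m n k : ℤ} (hm : m ≠ 0) {g : ℝ × ℝ → ℂ} (hg : ContinuousOn g K)
    (hgK : ∀ p ∈ K, Complex.exp (g p) =
      (toC p - toC a) ^ m * (toC p - toC b) ^ n * (toC p - toC c) ^ k) : False := by
  classical
  set U := connectedComponentIn Kᶜ a with hUdef
  have hUo : IsOpen U := hK.isOpen_compl.connectedComponentIn
  have haU : a ∈ U := mem_connectedComponentIn ha
  have hfr : frontier U ⊆ K := frontier_connectedComponentIn_subset hK a
  have hcl : closure U ⊆ U ∪ K := by
    rw [closure_eq_self_union_frontier]
    exact union_subset_union_right _ hfr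
  obtain ⟨G, hG⟩ := ContinuousMap.exists_restrict_eq hK
    (⟨K.domRestrict g, continuousOn_iff_continuous_domRestrict.1 hg⟩ : C(K, ℂ))
  have hGK : ∀ p ∈ K, G p = g p := fun p hp => congrArg (fun f : C(K, ℂ) => f ⟨p, hp⟩) hG
  let inner : ℝ × ℝ → ℂ := fun p =>
    Complex.exp (G p) * (toC p - toC b) ^ (-n) * (toC p - toC c) ^ (-k)
  let h : ℝ × ℝ → ℂ := U.piecewise inner fun p => (toC p - toC a) ^ m
  have hbne : ∀ p ∈ closure U, p ≠ b := fun p hp e => by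
    rcases hcl hp with h | h
    · exact hbU (e ▸ h)
    · exact hb (e ▸ h)
  have hcne : ∀ p ∈ closure U, p ≠ c := fun p hp e => by
    rcases hcl hp with h | h
    · exact hcU (e ▸ h)
    · exact hc (e ▸ h)
  have hcont : Continuous h := by
    refine continuous_piecewise ?_ ?_ ?_
    · intro p hp
      have hpK := hfr hp
      have h2 := toC_sub_ne_zero (hbne p hp.1)
      have h3 := toC_sub_ne_zero (hcne p hp.1)
      simp only [inner]
      rw [hGK p hpK, hgK p hpK, zpow_neg, zpow_neg]
      field_simp
    · refine ((Complex.continuous_exp.comp G.continuous).continuousOn.mul ?_).mul ?_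
      · exact toC_sub_zpow_continuousOn b _ fun hp => hbne b hp rfl
      · exact toC_sub_zpow_continuousOn c _ fun hp => hcne c hp rfl
    · refine toC_sub_zpow_continuousOn a _ ?_
      rw [closure_compl, hUo.interior_eq]
      exact fun hp => hp haU
  have hne : ∀ p, h p ≠ 0 := by
    intro p
    by_cases hp : p ∈ U
    · simp only [h, piecewise_eq_of_mem _ _ _ hp, inner]
      exact mul_ne_zero (mul_ne_zero (Complex.exp_ne_zero _)
        (zpow_ne_zero _ (toC_sub_ne_zero (hbne p (subset_closure hp)))))
        (zpow_ne_zero _ (toC_sub_ne_zero (hcne p (subset_closure hp))))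
    · simp only [h, piecewise_eq_of_notMem _ _ _ hp]
      exact zpow_ne_zero _ (toC_sub_ne_zero fun e => hp (e ▸ haU))
  obtain ⟨R, hR⟩ : ∃ R : ℝ, ∀ p ∈ U, ‖toC p - toC a‖ < R := by
    have hcomp : IsCompact (closure U) := hU.isCompact_closure
    obtain ⟨R, hR⟩ := (hcomp.image (f := fun p => ‖toC p - toC a‖)
      (by have := continuous_toC; fun_prop)).bddAbove
    refine ⟨R + 1, fun p hp => ?_⟩
    have := hR (mem_image_of_mem _ (subset_closure hp))
    linarith
  refine not_exists_extension_zpow a hm R hcont hne fun p hp => ?_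
  have : p ∉ U := fun hpU => absurd (hR p hpU) (not_lt.2 hp)
  simp only [h, piecewise_eq_of_notMem _ _ _ this]

/-- The complement of a compact planar set has at most one unbounded component. -/
lemma bounded_or_bounded {K : Set (ℝ × ℝ)} (hK : IsCompact K) {a b : ℝ × ℝ}
    (hab : connectedComponentIn Kᶜ a ≠ connectedComponentIn Kᶜ b) :
    Bornology.IsBounded (connectedComponentIn Kᶜ a) ∨
      Bornology.IsBounded (connectedComponentIn Kᶜ b) := by
  by_contra! hcon
  obtain ⟨h1, h2⟩ := hcon
  obtain ⟨R, hR⟩ := (hK.image (f := fun p => ‖toC p‖)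
    (by have := continuous_toC; fun_prop)).bddAbove
  set W : Set (ℝ × ℝ) := {p | max R 0 < ‖toC p‖} with hW
  have hWK : W ⊆ Kᶜ := fun p hp hpK => by
    have := hR (mem_image_of_mem _ hpK)
    have h3 : max R 0 < ‖toC p‖ := hp
    exact absurd (lt_of_le_of_lt (le_max_left _ _) h3) (not_lt.2 this)
  have hWc : IsPreconnected W := by
    have : W = (fun q : ℝ × ℝ => (q.1 * Real.cos q.2, q.1 * Real.sin q.2)) ''
        (Ioi (max R 0) ×ˢ univ) := by
      ext p
      constructor
      · intro hp
        refine ⟨(‖toC p‖, (toC p).arg), ⟨hp, mem_univ _⟩, ?_⟩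
        simp [toC]
      · rintro ⟨⟨r, θ⟩, ⟨hr, -⟩, rfl⟩
        have hr' : max R 0 < r := hr
        have h0 : 0 < r := lt_of_le_of_lt (le_max_right _ _) hr'
        have : toC (r * Real.cos θ, r * Real.sin θ) = r * Complex.exp (θ * Complex.I) := by
          rw [Complex.exp_mul_I]
          apply Complex.ext <;> simp [toC, Complex.cos_ofReal_re, Complex.sin_ofReal_re,
            Complex.cos_ofReal_im, Complex.sin_ofReal_im]
        simp only [hW, mem_ofPred_eq, this, norm_mul, Complex.norm_exp_ofReal_mul_I, mul_one,
          Complex.norm_real, Real.norm_eq_abs, abs_of_pos h0]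
        exact hr'
    rw [this]
    exact (isPreconnected_Ioi.prod isPreconnected_univ).image _ (by fun_prop)
  have hex : ∀ x, ¬ Bornology.IsBounded (connectedComponentIn Kᶜ x) →
      ∃ p ∈ W, p ∈ connectedComponentIn Kᶜ x := by
    intro x hx
    by_contra! hno
    apply hx
    refine (Metric.isBounded_closedBall (x := (0 : ℝ × ℝ)) (r := max R 0)).subset fun p hp => ?_
    have hp' : ¬ max R 0 < ‖toC p‖ := fun h => hno p h hp
    rw [mem_closedBall_zero_iff]
    refine le_trans ?_ (not_lt.1 hp')
    rw [Prod.norm_def]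
    exact max_le (Complex.abs_re_le_norm (toC p)) (Complex.abs_im_le_norm (toC p))
  obtain ⟨p, hpW, hpa⟩ := hex a h1
  obtain ⟨q, hqW, hqb⟩ := hex b h2
  apply hab
  rw [connectedComponentIn_eq hpa, connectedComponentIn_eq hqb]
  exact connectedComponentIn_eq (hWc.subset_connectedComponentIn hpW hWK hqW)

lemma no_log_of_two_ne_zero {K : Set (ℝ × ℝ)} (hK : IsCompact K) {a b c : ℝ × ℝ}
    (ha : a ∉ K) (hb : b ∉ K) (hc : c ∉ K)
    (hab : connectedComponentIn Kᶜ a ≠ connectedComponentIn Kᶜ b)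
    (hac : connectedComponentIn Kᶜ a ≠ connectedComponentIn Kᶜ c)
    (hbc : connectedComponentIn Kᶜ b ≠ connectedComponentIn Kᶜ c)
    {m n k : ℤ} (hm : m ≠ 0) (hn : n ≠ 0) {g : ℝ × ℝ → ℂ} (hg : ContinuousOn g K)
    (hgK : ∀ p ∈ K, Complex.exp (g p) =
      (toC p - toC a) ^ m * (toC p - toC b) ^ n * (toC p - toC c) ^ k) : False := by
  rcases bounded_or_bounded hK hab with hU | hU
  · exact no_log_of_bounded_component hK.isClosed ha hb hc hU
      (fun h => hab (connectedComponentIn_eq h)) (fun h => hac (connectedComponentIn_eq h))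
      hm hg hgK
  · refine no_log_of_bounded_component hK.isClosed hb ha hc hU
      (fun h => hab (connectedComponentIn_eq h).symm)
      (fun h => hbc (connectedComponentIn_eq h)) hn hg (k := k) (n := m) fun p hp => ?_
    rw [hgK p hp]
    ring

lemma exists_log_of_same_component {K : Set (ℝ × ℝ)} (hK : IsClosed K) {a c : ℝ × ℝ}
    (ha : a ∉ K) (hc : c ∉ K)
    (hac : connectedComponentIn Kᶜ a = connectedComponentIn Kᶜ c) :
    ∃ g : ℝ × ℝ → ℂ, ContinuousOn g K ∧
      ∀ p ∈ K, Complex.exp (g p) = (toC p - toC a) * (toC p - toC c)⁻¹ := by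
  classical
  set U := connectedComponentIn Kᶜ c with hU
  have hUo : IsOpen U := hK.isOpen_compl.connectedComponentIn
  have hcU : c ∈ U := mem_connectedComponentIn hc
  have haU : a ∈ U := hac ▸ mem_connectedComponentIn ha
  have hUK : U ⊆ Kᶜ := connectedComponentIn_subset _ _
  have hpc : IsPathConnected U :=
    hUo.isConnected_iff_isPathConnected.1 (isConnected_connectedComponentIn_iff.2 hc)
  obtain ⟨γ, hγ⟩ := hpc.joinedIn c hcU a haU
  have hne : ∀ (t : unitInterval) (p : K), toC p - toC (γ t) ≠ 0 := fun t p =>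
    toC_sub_ne_zero fun h => hUK (hγ t) (h ▸ p.2)
  have hnc : ∀ p : K, toC p - toC c ≠ 0 := fun p => toC_sub_ne_zero fun h => hc (h ▸ p.2)
  have hcontC := continuous_toC
  let H : C(unitInterval × K, {z : ℂ // z ≠ 0}) :=
    ⟨fun q => ⟨(toC q.2 - toC (γ q.1)) * (toC q.2 - toC c)⁻¹,
      mul_ne_zero (hne _ _) (inv_ne_zero (hnc _))⟩, by
      refine Continuous.subtype_mk ?_ _
      refine Continuous.mul (by fun_prop) (Continuous.inv₀ (by fun_prop) fun q => hnc q.2)⟩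
  let f : C(K, ℂ) := ⟨fun _ => 0, continuous_const⟩
  have H0 : ∀ p : K, H (0, p) = (fun z : ℂ ↦ (⟨_, z.exp_ne_zero⟩ : {z : ℂ // z ≠ 0})) (f p) := by
    intro p
    apply Subtype.ext
    simp only [H, f, ContinuousMap.coe_mk, γ.source, Complex.exp_zero]
    exact mul_inv_cancel₀ (hnc p)
  let L := Complex.isCoveringMap_exp.liftHomotopy H f H0
  have hL : ∀ q, Complex.exp (L q) = (H q : ℂ) := fun q =>
    congrArg Subtype.val (congrFun (Complex.isCoveringMap_exp.liftHomotopy_lifts H f H0) q)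
  refine ⟨fun p => if hp : p ∈ K then L (1, ⟨p, hp⟩) else 0, ?_, ?_⟩
  · rw [continuousOn_iff_continuous_domRestrict]
    have : K.domRestrict (fun p => if hp : p ∈ K then L (1, ⟨p, hp⟩) else 0) =
        fun p : K => L (1, p) := by
      ext p
      simp
    rw [this]
    fun_prop
  · intro p hp
    simp only [hp, dif_pos, hL]
    simp [H, γ.target]

lemma continuousOn_invFunOn_Icc {γ : ℝ → ℝ × ℝ} (hγ : ContinuousOn γ (Icc 0 1))
    (hinj : InjOn γ (Icc 0 1)) :
    ContinuousOn (Function.invFunOn γ (Icc 0 1)) (γ '' Icc 0 1) := by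
  have hleft : ∀ t ∈ Icc (0 : ℝ) 1, Function.invFunOn γ (Icc 0 1) (γ t) = t :=
    fun t ht => hinj.leftInvOn_invFunOn ht
  rw [continuousOn_iff_isClosed]
  intro s hs
  refine ⟨γ '' (Icc 0 1 ∩ s), ?_, ?_⟩
  · exact ((isCompact_Icc.inter_right hs).image_of_continuousOn
      (hγ.mono inter_subset_left)).isClosed
  · ext p
    constructor
    · rintro ⟨hp, t, ht, rfl⟩
      refine ⟨⟨t, ⟨ht, ?_⟩, rfl⟩, t, ht, rfl⟩
      have : Function.invFunOn γ (Icc 0 1) (γ t) ∈ s := hp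
      rwa [hleft t ht] at this
    · rintro ⟨⟨t, ⟨ht, hts⟩, rfl⟩, -⟩
      refine ⟨?_, t, ht, rfl⟩
      show Function.invFunOn γ (Icc 0 1) (γ t) ∈ s
      rwa [hleft t ht]

lemma exists_log_on_arc {γ : ℝ → ℝ × ℝ} (hγ : ContinuousOn γ (Icc 0 1))
    (hinj : InjOn γ (Icc 0 1)) {a c : ℝ × ℝ} (ha : a ∉ γ '' Icc 0 1) (hc : c ∉ γ '' Icc 0 1) :
    ∃ h : ℝ × ℝ → ℂ, ContinuousOn h (γ '' Icc 0 1) ∧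
      ∀ p ∈ γ '' Icc 0 1, Complex.exp (h p) = (toC p - toC a) * (toC p - toC c)⁻¹ := by
  let δ : ℝ → ℝ × ℝ := Set.IccExtend zero_le_one ((Icc (0 : ℝ) 1).domRestrict γ)
  have hδ : Continuous δ := (continuousOn_iff_continuous_domRestrict.1 hγ).Icc_extend'
  have hδmem : ∀ t, δ t ∈ γ '' Icc 0 1 := fun t =>
    ⟨projIcc 0 1 zero_le_one t, (projIcc 0 1 zero_le_one t).2, rfl⟩
  have hδeq : ∀ t ∈ Icc (0 : ℝ) 1, δ t = γ t := fun t ht => by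
    simp [δ, IccExtend_of_mem _ _ ht]
  have hcontC := continuous_toC
  have hna : ∀ t, toC (δ t) - toC a ≠ 0 := fun t => toC_sub_ne_zero fun h => ha (h ▸ hδmem t)
  have hnc : ∀ t, toC (δ t) - toC c ≠ 0 := fun t => toC_sub_ne_zero fun h => hc (h ▸ hδmem t)
  obtain ⟨G, hG, hGe⟩ := exists_continuous_log
    (f := fun t => (toC (δ t) - toC a) * (toC (δ t) - toC c)⁻¹)
    (Continuous.mul (by fun_prop) (Continuous.inv₀ (by fun_prop) hnc))
    fun t => mul_ne_zero (hna t) (inv_ne_zero (hnc t))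
  refine ⟨G ∘ Function.invFunOn γ (Icc 0 1),
    hG.comp_continuousOn (continuousOn_invFunOn_Icc hγ hinj), ?_⟩
  rintro _ ⟨t, ht, rfl⟩
  simp only [Function.comp_apply, hinj.leftInvOn_invFunOn ht, hGe, hδeq t ht]

lemma exists_glue {s t : Set (ℝ × ℝ)} (hs : IsClosed s) (ht : IsClosed t) {g h : ℝ × ℝ → ℂ}
    (hg : ContinuousOn g s) (hh : ContinuousOn h t) (heq : ∀ p ∈ s ∩ t, g p = h p) :
    ∃ F : ℝ × ℝ → ℂ, ContinuousOn F (s ∪ t) ∧ (∀ p ∈ s, F p = g p) ∧ ∀ p ∈ t, F p = h p := by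
  classical
  have h1 : ∀ p ∈ s, s.piecewise g h p = g p := fun p hp => piecewise_eq_of_mem _ _ _ hp
  have h2 : ∀ p ∈ t, s.piecewise g h p = h p := by
    intro p hp
    by_cases hps : p ∈ s
    · rw [h1 p hps, heq p ⟨hps, hp⟩]
    · exact piecewise_eq_of_notMem _ _ _ hps
  exact ⟨s.piecewise g h, (hg.congr h1).union_of_isClosed (hh.congr h2) hs ht, h1, h2⟩

/-- Logarithms of `(z - a) / (z - c)` on a closed set and on an arc that meets it in its
endpoints, normalised to agree at the first endpoint. -/
lemma exists_log_defect {K : Set (ℝ × ℝ)} (hK : IsClosed K) {γ : ℝ → ℝ × ℝ}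
    (hγ : ContinuousOn γ (Icc 0 1)) (hinj : InjOn γ (Icc 0 1)) (h0 : γ 0 ∈ K) (h1 : γ 1 ∈ K)
    {a c : ℝ × ℝ} (ha : a ∉ K ∪ γ '' Icc 0 1) (hc : c ∉ K ∪ γ '' Icc 0 1)
    (hac : connectedComponentIn Kᶜ a = connectedComponentIn Kᶜ c) :
    ∃ (g h : ℝ × ℝ → ℂ) (d : ℤ), ContinuousOn g K ∧ ContinuousOn h (γ '' Icc 0 1) ∧
      (∀ p ∈ K, Complex.exp (g p) = (toC p - toC a) * (toC p - toC c)⁻¹) ∧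
      (∀ p ∈ γ '' Icc 0 1, Complex.exp (h p) = (toC p - toC a) * (toC p - toC c)⁻¹) ∧
      g (γ 0) = h (γ 0) ∧ g (γ 1) = h (γ 1) + d * (2 * Real.pi * Complex.I) := by
  rw [mem_union, not_or] at ha hc
  obtain ⟨g, hg, hge⟩ := exists_log_of_same_component hK ha.1 hc.1 hac
  obtain ⟨h, hh, hhe⟩ := exists_log_on_arc hγ hinj ha.2 hc.2
  have m0 : γ 0 ∈ γ '' Icc 0 1 := mem_image_of_mem _ (by simp)
  have m1 : γ 1 ∈ γ '' Icc 0 1 := mem_image_of_mem _ (by simp)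
  have e0 : Complex.exp (g (γ 0) - h (γ 0)) = 1 := by
    rw [Complex.exp_sub, hge _ h0, hhe _ m0, ← hhe _ m0]
    exact div_self (Complex.exp_ne_zero _)
  have he : ∀ p ∈ K, Complex.exp (g p - (g (γ 0) - h (γ 0))) =
      (toC p - toC a) * (toC p - toC c)⁻¹ := by
    intro p hp
    rw [Complex.exp_sub, e0, hge p hp, div_one]
  have e1 : Complex.exp (g (γ 1) - (g (γ 0) - h (γ 0)) - h (γ 1)) = 1 := by
    rw [Complex.exp_sub, he _ h1, hhe _ m1, ← hhe _ m1]
    exact div_self (Complex.exp_ne_zero _)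
  obtain ⟨d, hd⟩ := Complex.exp_eq_one_iff.1 e1
  refine ⟨fun p => g p - (g (γ 0) - h (γ 0)), h, d, hg.sub continuousOn_const, hh, he, hhe, ?_, ?_⟩
  · ring
  · rw [← hd]
    ring

/-- An arc attached to a compact set along its endpoints borders at most two of the components
of the complement that lie in a common component of the complement of the compact set. -/
lemma arc_has_two_sides {K : Set (ℝ × ℝ)} (hK : IsCompact K) {γ : ℝ → ℝ × ℝ}
    (hγ : ContinuousOn γ (Icc 0 1)) (hinj : InjOn γ (Icc 0 1)) (h0 : γ 0 ∈ K) (h1 : γ 1 ∈ K)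
    (hends : K ∩ γ '' Icc 0 1 ⊆ {γ 0, γ 1}) {a b c : ℝ × ℝ}
    (ha : a ∉ K ∪ γ '' Icc 0 1) (hb : b ∉ K ∪ γ '' Icc 0 1) (hc : c ∉ K ∪ γ '' Icc 0 1)
    (hac : connectedComponentIn Kᶜ a = connectedComponentIn Kᶜ c)
    (hbc : connectedComponentIn Kᶜ b = connectedComponentIn Kᶜ c)
    (dab : connectedComponentIn (K ∪ γ '' Icc 0 1)ᶜ a ≠ connectedComponentIn (K ∪ γ '' Icc 0 1)ᶜ b)
    (dac : connectedComponentIn (K ∪ γ '' Icc 0 1)ᶜ a ≠ connectedComponentIn (K ∪ γ '' Icc 0 1)ᶜ c)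
    (dbc : connectedComponentIn (K ∪ γ '' Icc 0 1)ᶜ b ≠
      connectedComponentIn (K ∪ γ '' Icc 0 1)ᶜ c) : False := by
  obtain ⟨g, h, p, hg, hh, hge, hhe, g0, g1⟩ :=
    exists_log_defect hK.isClosed hγ hinj h0 h1 ha hc hac
  obtain ⟨g', h', q, hg', hh', hge', hhe', g0', g1'⟩ :=
    exists_log_defect hK.isClosed hγ hinj h0 h1 hb hc hbc
  have hAc : IsCompact (γ '' Icc 0 1) := isCompact_Icc.image_of_continuousOn hγ
  have key : ∀ m n : ℤ, m * p + n * q = 0 → ∃ F : ℝ × ℝ → ℂ,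
      ContinuousOn F (K ∪ γ '' Icc 0 1) ∧ ∀ z ∈ K ∪ γ '' Icc 0 1, Complex.exp (F z) =
        (toC z - toC a) ^ m * (toC z - toC b) ^ n * (toC z - toC c) ^ (-(m + n)) := by
    intro m n hmn
    obtain ⟨F, hF, hF1, hF2⟩ := exists_glue hK.isClosed hAc.isClosed
      (g := fun z => m * g z + n * g' z) (h := fun z => m * h z + n * h' z)
      (by fun_prop) (by fun_prop) (by
        intro z hz
        rcases hends hz with rfl | hz1
        · simp only [g0, g0']
        · have hz2 : z = γ 1 := hz1
          subst hz2
          have : (m : ℂ) * p + n * q = 0 := by exact_mod_cast hmn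
          simp only [g1, g1']
          linear_combination (2 * Real.pi * Complex.I) * this)
    have hexp : ∀ z ∈ K ∪ γ '' Icc 0 1, ∀ x y : ℂ,
        Complex.exp x = (toC z - toC a) * (toC z - toC c)⁻¹ →
        Complex.exp y = (toC z - toC b) * (toC z - toC c)⁻¹ → Complex.exp (m * x + n * y) =
        (toC z - toC a) ^ m * (toC z - toC b) ^ n * (toC z - toC c) ^ (-(m + n)) := by
      intro z hz x y hx hy
      have hzc : toC z - toC c ≠ 0 := toC_sub_ne_zero fun h => hc (h ▸ hz)
      rw [Complex.exp_add, Complex.exp_int_mul, Complex.exp_int_mul, hx, hy, mul_zpow, mul_zpow,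
        neg_add, zpow_add₀ hzc, inv_zpow', inv_zpow']
      ring
    refine ⟨F, hF, fun z hz => ?_⟩
    rcases hz with hz | hz
    · rw [hF1 z hz]
      exact hexp z (Or.inl hz) _ _ (hge z hz) (hge' z hz)
    · rw [hF2 z hz]
      exact hexp z (Or.inr hz) _ _ (hhe z hz) (hhe' z hz)
  have hKA := hK.union hAc
  by_cases hp : p = 0
  · obtain ⟨F, hF, hFe⟩ := key 1 0 (by simp [hp])
    refine no_log_of_two_ne_zero hKA ha hc hb dac dab dbc.symm (m := 1) (n := -1) (k := 0)
      one_ne_zero (by simp) hF fun z hz => ?_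
    rw [hFe z hz]
    simp
  by_cases hq : q = 0
  · obtain ⟨F, hF, hFe⟩ := key 0 1 (by simp [hq])
    refine no_log_of_two_ne_zero hKA hb hc ha dbc dab.symm dac.symm (m := 1) (n := -1) (k := 0)
      one_ne_zero (by simp) hF fun z hz => ?_
    rw [hFe z hz]
    simp
  · obtain ⟨F, hF, hFe⟩ := key q (-p) (by ring)
    exact no_log_of_two_ne_zero hKA ha hb hc dab dac dbc hq (neg_ne_zero.2 hp) hF hFe

/-- `x` and `y` are joined by a simple arc (possibly a single point) inside `S`. -/
def ArcJoinedIn {X : Type*} [TopologicalSpace X] (S : Set X) (x y : X) : Prop :=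
  ∃ (γ : ℝ → X) (a b : ℝ), a ≤ b ∧ ContinuousOn γ (Icc a b) ∧ InjOn γ (Icc a b) ∧
    γ a = x ∧ γ b = y ∧ MapsTo γ (Icc a b) S

namespace ArcJoinedIn

variable {X : Type*} [TopologicalSpace X] {S T : Set X} {x y z : X}

lemma mono (h : ArcJoinedIn S x y) (hST : S ⊆ T) : ArcJoinedIn T x y := by
  obtain ⟨γ, a, b, hab, hc, hi, h0, h1, hm⟩ := h
  exact ⟨γ, a, b, hab, hc, hi, h0, h1, fun t ht => hST (hm ht)⟩

lemma symm (h : ArcJoinedIn S x y) : ArcJoinedIn S y x := by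
  obtain ⟨γ, a, b, hab, hc, hi, h0, h1, hm⟩ := h
  have hneg : MapsTo (fun t : ℝ => -t) (Icc (-b) (-a)) (Icc a b) := fun t ht =>
    ⟨by linarith [ht.2], by linarith [ht.1]⟩
  refine ⟨fun t => γ (-t), -b, -a, by linarith, hc.comp continuous_neg.continuousOn hneg,
    fun s hs t ht hst => neg_injective (hi (hneg hs) (hneg ht) hst), by simpa, by simpa,
    fun t ht => hm (hneg ht)⟩

lemma of_subarc {γ : ℝ → X} {a b : ℝ} (hab : a ≤ b) (hc : ContinuousOn γ (Icc a b))
    (hi : InjOn γ (Icc a b)) (hm : MapsTo γ (Icc a b) S) : ArcJoinedIn S (γ a) (γ b) :=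
  ⟨γ, a, b, hab, hc, hi, rfl, rfl, hm⟩

lemma trans [T2Space X] (h : ArcJoinedIn S x y) (h' : ArcJoinedIn S y z) :
    ArcJoinedIn S x z := by
  obtain ⟨α, a, b, hab, hc, hi, h0, h1, hm⟩ := h
  obtain ⟨β, c, d, hcd, hc', hi', h0', h1', hm'⟩ := h'
  have hcl : IsCompact (Icc a b ∩ α ⁻¹' (β '' Icc c d)) :=
    isCompact_Icc.of_isClosed_subset
      (hc.preimage_isClosed_of_isClosed isClosed_Icc
        (isCompact_Icc.image_of_continuousOn hc').isClosed) inter_subset_left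
  obtain ⟨t₀, ⟨ht₀, s₀, hs₀, hst⟩, hmin⟩ :=
    hcl.exists_isLeast ⟨b, ⟨hab, le_rfl⟩, c, ⟨le_rfl, hcd⟩, by rw [h0', h1]⟩
  have hshift : ∀ t ∈ Icc a (t₀ + (d - s₀)), ¬ t < t₀ → t - t₀ + s₀ ∈ Icc c d := fun t ht h =>
    ⟨by linarith [hs₀.1, not_lt.1 h], by linarith [ht.2]⟩
  have hleft : ∀ t ∈ Icc a (t₀ + (d - s₀)), t ≤ t₀ → t ∈ Icc a b := fun t ht h =>
    ⟨ht.1, h.trans ht₀.2⟩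
  have hsep : ∀ t ∈ Icc a (t₀ + (d - s₀)), t ≤ t₀ → ∀ t' ∈ Icc a (t₀ + (d - s₀)), ¬ t' ≤ t₀ →
      α t ≠ β (t' - t₀ + s₀) := by
    intro t ht h t' ht' h' e
    have h2 := hshift t' ht' (fun h3 => h' h3.le)
    have : t₀ ≤ t := hmin ⟨hleft t ht h, _, h2, e.symm⟩
    obtain rfl := le_antisymm h this
    have := hi' hs₀ h2 (hst.trans e)
    apply h'; linarith
  refine ⟨fun t => if t ≤ t₀ then α t else β (t - t₀ + s₀), a, t₀ + (d - s₀),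
    by linarith [ht₀.1, hs₀.2], ?_, ?_, ?_, ?_, ?_⟩
  · refine ContinuousOn.if ?_ ?_ ?_
    · rintro t ⟨ht, hf⟩
      have : t = t₀ := by
        have := frontier_le_subset_eq continuous_id continuous_const hf
        simpa using this
      subst this
      simp [hst]
    · refine hc.mono fun t ht => ?_
      have : t ≤ t₀ := by
        have := ht.2
        rwa [show {a | a ≤ t₀} = Iic t₀ from rfl, closure_Iic] at this
      exact hleft t ht.1 this
    · refine hc'.comp (by fun_prop) fun t ht => ?_
      have : t₀ ≤ t := by
        have := ht.2
        rw [show {a | ¬ a ≤ t₀} = Ioi t₀ from by ext; simp, closure_Ioi] at this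
        exact this
      exact hshift t ht.1 (not_lt.2 this)
  · intro t ht t' ht' e
    by_cases h : t ≤ t₀ <;> by_cases h' : t' ≤ t₀ <;> simp only [h, h', if_true, if_false] at e
    · exact hi (hleft t ht h) (hleft t' ht' h') e
    · exact absurd e (hsep t ht h t' ht' h')
    · exact absurd e.symm (hsep t' ht' h' t ht h)
    · have := hi' (hshift t ht fun h3 => h h3.le) (hshift t' ht' fun h3 => h' h3.le) e
      linarith
  · simp [ht₀.1, h0]
  · by_cases h : t₀ + (d - s₀) ≤ t₀
    · have : s₀ = d := le_antisymm hs₀.2 (by linarith)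
      subst this
      simp [← h1', hst]
    · simp only [h, if_false]
      rw [← h1']; congr 1; ring
  · intro t ht
    by_cases h : t ≤ t₀ <;> simp only [h, if_true, if_false]
    · exact hm (hleft t ht h)
    · exact hm' (hshift t ht fun h3 => h h3.le)

end ArcJoinedIn

lemma IsOpen.arcJoinedIn {E : Type*} [NormedAddCommGroup E] [NormedSpace ℝ E] {S : Set E}
    (hS : IsOpen S) (hc : IsPreconnected S) {x y : E} (hx : x ∈ S) (hy : y ∈ S) :
    ArcJoinedIn S x y := by
  refine hc.induction₂ (ArcJoinedIn S) (fun x hx => ?_) (fun x y z _ _ _ h h' => h.trans h')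
    (fun x y _ _ h => h.symm) hx hy
  obtain ⟨r, hr, hball⟩ := Metric.isOpen_iff.1 hS x hx
  filter_upwards [mem_nhdsWithin_of_mem_nhds (Metric.ball_mem_nhds x hr)] with y hy
  by_cases hxy : x = y
  · subst hxy
    exact ⟨fun _ => x, 0, 0, le_rfl, continuousOn_const, by simp, rfl, rfl, fun _ _ => hx⟩
  · refine ⟨AffineMap.lineMap x y, 0, 1, zero_le_one, AffineMap.lineMap_continuous.continuousOn,
      (AffineMap.lineMap_injective ℝ hxy).injOn, by simp, by simp, fun t ht => hball ?_⟩
    exact (convex_ball x r).lineMap_mem (Metric.mem_ball_self hr) hy ht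

lemma arcJoinedIn_of_same_component {K : Set (ℝ × ℝ)} (hK : IsClosed K) {a b : ℝ × ℝ}
    (ha : a ∉ K) (hb : b ∉ K) (h : connectedComponentIn Kᶜ a = connectedComponentIn Kᶜ b) :
    ArcJoinedIn Kᶜ a b :=
  (IsOpen.arcJoinedIn (hK.isOpen_compl.connectedComponentIn) isPreconnected_connectedComponentIn
    (mem_connectedComponentIn ha) (h ▸ mem_connectedComponentIn hb)).mono
    (connectedComponentIn_subset _ _)

lemma ArcJoinedIn.exists_minimal {X : Type*} [TopologicalSpace X] [DecidableEq X] {U : Set X}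
    {x y : X} (T₀ : Finset X) (h : ArcJoinedIn (U ∪ T₀) x y) :
    ∃ T ⊆ T₀, ArcJoinedIn (U ∪ T) x y ∧ ∀ p ∈ T, ¬ ArcJoinedIn (U ∪ ↑(T.erase p)) x y := by
  induction T₀ using Finset.strongInduction with
  | H T₀ ih =>
    by_cases hp : ∃ p ∈ T₀, ArcJoinedIn (U ∪ ↑(T₀.erase p)) x y
    · obtain ⟨p, hp, h'⟩ := hp
      obtain ⟨T, hT, h1, h2⟩ := ih _ (Finset.erase_ssubset hp) h'
      exact ⟨T, hT.trans (Finset.erase_subset _ _), h1, h2⟩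
    · push Not at hp
      exact ⟨T₀, Finset.Subset.refl _, h, hp⟩

/-- Around an interior parameter of an arc, the parameters of finitely many other points can be
avoided. -/
lemma exists_isolating_interval {F : Set ℝ} (hF : F.Finite) {a b t : ℝ} (ha : a ∈ F) (hb : b ∈ F)
    (hat : a < t) (htb : t < b) :
    ∃ l r, a < l ∧ l < t ∧ t < r ∧ r < b ∧ ∀ s ∈ Icc l r, s ∈ F → s = t := by
  have hcl : IsClosed (F \ {t}) := (hF.subset sdiff_subset).isClosed
  have hnhds : (F \ {t})ᶜ ∈ nhds t := hcl.isOpen_compl.mem_nhds (by simp)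
  obtain ⟨ε, hε, hb'⟩ := Metric.mem_nhds_iff.1 hnhds
  have key : ∀ s, |s - t| < ε → s ∈ F → s = t := by
    intro s hs hsF
    by_contra hne
    exact hb' (by simpa [Real.dist_eq] using hs) ⟨hsF, hne⟩
  have h1 : a < t - ε / 2 := by
    by_contra! h
    exact hat.ne (key a (by rw [abs_lt]; constructor <;> linarith) ha)
  have h2 : t + ε / 2 < b := by
    by_contra! h
    exact htb.ne' (key b (by rw [abs_lt]; constructor <;> linarith) hb)
  refine ⟨t - ε / 2, t + ε / 2, h1, by linarith, by linarith, h2, fun s hs => key s ?_⟩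
  rw [abs_lt]; constructor <;> linarith [hs.1, hs.2]

/-- If `δ` is an arc crossing the closed set `K` in as few points as possible, then an arc `γ`
contained in `K` is met at most once. -/
lemma minimal_arc_meets_once [DecidableEq (ℝ × ℝ)] {K K' : Set (ℝ × ℝ)} (hK' : IsCompact K')
    {γ : ℝ → ℝ × ℝ} (hγ : ContinuousOn γ (Icc 0 1)) (hinj : InjOn γ (Icc 0 1)) (h0 : γ 0 ∈ K')
    (h1 : γ 1 ∈ K') (hends : K' ∩ γ '' Icc 0 1 ⊆ {γ 0, γ 1}) (hK : K = K' ∪ γ '' Icc 0 1)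
    {x y : ℝ × ℝ} {T : Finset (ℝ × ℝ)} (hjoin : ArcJoinedIn (Kᶜ ∪ {x, y} ∪ T) x y)
    (hmin : ∀ p ∈ T, ¬ ArcJoinedIn (Kᶜ ∪ {x, y} ∪ ↑(T.erase p)) x y)
    {p q : ℝ × ℝ} (hp : p ∈ T) (hq : q ∈ T) (hpq : p ≠ q) (hpx : p ≠ x) (hpy : p ≠ y)
    (hqx : q ≠ x) (hqy : q ≠ y) (hpγ : p ∈ γ '' Icc 0 1) (hqγ : q ∈ γ '' Icc 0 1)
    (hpK : p ∉ K') (hqK : q ∉ K') : False := by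
  have hKc : IsClosed K := by
    rw [hK]; exact (hK'.union (isCompact_Icc.image_of_continuousOn hγ)).isClosed
  obtain ⟨δ, α, β, hαβ, hδ, hδi, hα, hβ, hδm⟩ := hjoin
  have hαI : α ∈ Icc α β := ⟨le_rfl, hαβ⟩
  have hβI : β ∈ Icc α β := ⟨hαβ, le_rfl⟩
  have hit : ∀ r ∈ T, r ≠ x → r ≠ y → ∃ t, α < t ∧ t < β ∧ δ t = r := by
    intro r hr hrx hry
    by_contra! hno
    refine hmin r hr ⟨δ, α, β, hαβ, hδ, hδi, hα, hβ, fun t ht => ?_⟩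
    rcases hδm ht with h | h
    · exact Or.inl h
    · refine Or.inr (Finset.mem_coe.2 (Finset.mem_erase.2 ⟨fun e => ?_, h⟩))
      refine hno t (ht.1.lt_of_ne fun e' => ?_) (ht.2.lt_of_ne fun e' => ?_) e
      · subst e'; exact hrx (e.symm.trans hα)
      · subst e'; exact hry (e.symm.trans hβ)
  set P : Set (ℝ × ℝ) := {x, y} with hP
  have hsub : ∀ (r : ℝ × ℝ) (s t : ℝ), α ≤ s → s ≤ t → t ≤ β → r ∉ δ '' Icc s t →
      ArcJoinedIn (Kᶜ ∪ P ∪ ↑(T.erase r)) (δ s) (δ t) := by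
    intro r s t hs hst ht hr
    have hss : Icc s t ⊆ Icc α β := Icc_subset_Icc hs ht
    refine ArcJoinedIn.of_subarc hst (hδ.mono hss) (hδi.mono hss) fun u hu => ?_
    rcases hδm (hss hu) with h | h
    · exact Or.inl h
    · exact Or.inr (Finset.mem_coe.2 (Finset.mem_erase.2 ⟨fun e => hr ⟨u, hu, e⟩, h⟩))
  have hout : ∀ t s r, t ∈ Icc α β → (t < s ∨ r < t) → δ t ∉ δ '' Icc s r ∨ ¬ (α ≤ s ∧ r ≤ β) := by
    intro t s r ht h
    by_contra! hh
    obtain ⟨⟨u, hu, e⟩, hs, hr⟩ := hh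
    have := hδi ⟨hs.trans hu.1, hu.2.trans hr⟩ ht e
    subst this
    rcases h with h | h
    · exact h.not_ge hu.1
    · exact h.not_ge hu.2
  have hFfin : {t | t ∈ Icc α β ∧ δ t ∈ P ∪ ↑T}.Finite := by
    refine Finite.of_injOn (f := δ) (t := P ∪ ↑T) (fun t ht => ht.2)
      (hδi.mono fun t ht => ht.1) ?_
    exact Finite.union (by simp [hP]) T.finite_toSet
  have hbypass : ∀ (r : ℝ) (s t : ℝ), α ≤ s → s < r → r < t → t ≤ β → δ r ∈ T →
      δ s ∉ K → δ t ∉ K → connectedComponentIn Kᶜ (δ s) ≠ connectedComponentIn Kᶜ (δ t) := by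
    intro r s t hs hsr hrt ht hr hsK htK e
    refine hmin (δ r) hr ?_
    have hrI : r ∈ Icc α β := ⟨hs.trans hsr.le, hrt.le.trans ht⟩
    rw [← hα, ← hβ]
    refine ((hsub (δ r) α s le_rfl hs (hsr.le.trans hrI.2) ?_).trans
      ((arcJoinedIn_of_same_component hKc hsK htK e).mono ?_)).trans
      (hsub (δ r) t β (hrI.1.trans hrt.le) ht le_rfl ?_)
    · exact (hout r α s hrI (Or.inr hsr)).resolve_right
        (not_not.2 ⟨le_rfl, hsr.le.trans hrI.2⟩)
    · exact fun z hz => Or.inl (Or.inl hz)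
    · exact (hout r t β hrI (Or.inl hrt)).resolve_right
        (not_not.2 ⟨hrI.1.trans hrt.le, le_rfl⟩)
  have hcomp : ∀ C : Set (ℝ × ℝ), C ⊆ K'ᶜ → IsPreconnected C → ∀ a ∈ C, ∀ b ∈ C,
      connectedComponentIn K'ᶜ a = connectedComponentIn K'ᶜ b := fun C hC hCc a ha b hb =>
    connectedComponentIn_eq (hCc.subset_connectedComponentIn ha hC hb)
  have hlocal : ∀ l t r, α < l → l < t → t < r → r < β → δ t ∉ K' →
      (∀ s ∈ Icc l r, s ∈ {t | t ∈ Icc α β ∧ δ t ∈ P ∪ ↑T} → s = t) →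
      δ l ∉ K ∧ δ r ∉ K ∧ connectedComponentIn K'ᶜ (δ l) = connectedComponentIn K'ᶜ (δ t) ∧
        connectedComponentIn K'ᶜ (δ r) = connectedComponentIn K'ᶜ (δ t) := by
    intro l t r hl hlt htr hr htK h
    have hss : Icc l r ⊆ Icc α β := Icc_subset_Icc hl.le hr.le
    have hoff : ∀ s ∈ Icc l r, s ≠ t → δ s ∉ K := by
      intro s hs hst
      have hnot : δ s ∉ P ∪ ↑T := fun h' => hst (h s hs ⟨hss hs, h'⟩)
      rcases hδm (hss hs) with (h' | h') | h'
      · exact h'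
      · exact absurd (Or.inl h') hnot
      · exact absurd (Or.inr h') hnot
    have hC : δ '' Icc l r ⊆ K'ᶜ := by
      rintro _ ⟨s, hs, rfl⟩
      by_cases hst : s = t
      · rwa [hst]
      · exact fun h' => hoff s hs hst (hK ▸ Or.inl h')
    have hCc : IsPreconnected (δ '' Icc l r) := isPreconnected_Icc.image _ (hδ.mono hss)
    have hlr := hlt.le.trans htr.le
    refine ⟨hoff l ⟨le_rfl, hlr⟩ hlt.ne, hoff r ⟨hlr, le_rfl⟩ htr.ne',
      hcomp _ hC hCc _ ⟨l, ⟨le_rfl, hlr⟩, rfl⟩ _ ⟨t, ⟨hlt.le, htr.le⟩, rfl⟩,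
      hcomp _ hC hCc _ ⟨r, ⟨hlr, le_rfl⟩, rfl⟩ _ ⟨t, ⟨hlt.le, htr.le⟩, rfl⟩⟩
  have hopen : γ '' Ioo 0 1 ⊆ K'ᶜ := by
    rintro _ ⟨s, hs, rfl⟩ hsK
    have hsI : s ∈ Icc (0:ℝ) 1 := Ioo_subset_Icc_self hs
    rcases hends ⟨hsK, s, hsI, rfl⟩ with e | e
    · exact hs.1.ne' (hinj hsI ⟨le_rfl, zero_le_one⟩ e)
    · exact hs.2.ne (hinj hsI ⟨zero_le_one, le_rfl⟩ e)
  have hinterior : ∀ z ∈ γ '' Icc 0 1, z ∉ K' → z ∈ γ '' Ioo 0 1 := by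
    rintro _ ⟨s, hs, rfl⟩ hz
    refine ⟨s, ⟨hs.1.lt_of_ne fun e => hz (e ▸ h0), hs.2.lt_of_ne fun e => hz (e ▸ h1)⟩, rfl⟩
  have hpqc : connectedComponentIn K'ᶜ p = connectedComponentIn K'ᶜ q :=
    hcomp _ hopen (isPreconnected_Ioo.image _ (hγ.mono Ioo_subset_Icc_self)) _
      (hinterior p hpγ hpK) _ (hinterior q hqγ hqK)
  have main : ∀ tp tq, α < tp → tp < tq → tq < β → δ tp ∈ T → δ tq ∈ T → δ tp ∉ K' → δ tq ∉ K' →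
      connectedComponentIn K'ᶜ (δ tp) = connectedComponentIn K'ᶜ (δ tq) → False := by
    intro tp tq h1 h2 h3 hpT hqT hpK hqK hpq
    have hFα : α ∈ {t | t ∈ Icc α β ∧ δ t ∈ P ∪ ↑T} := ⟨hαI, Or.inl (by simp [hP, hα])⟩
    have hFβ : β ∈ {t | t ∈ Icc α β ∧ δ t ∈ P ∪ ↑T} := ⟨hβI, Or.inl (by simp [hP, hβ])⟩
    have hFp : tp ∈ {t | t ∈ Icc α β ∧ δ t ∈ P ∪ ↑T} := ⟨⟨h1.le, (h2.trans h3).le⟩, Or.inr hpT⟩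
    have hFq : tq ∈ {t | t ∈ Icc α β ∧ δ t ∈ P ∪ ↑T} := ⟨⟨(h1.trans h2).le, h3.le⟩, Or.inr hqT⟩
    obtain ⟨l, r, a1, a2, a3, a4, a5⟩ := exists_isolating_interval hFfin hFα hFq h1 h2
    obtain ⟨l', r', b1, b2, b3, b4, b5⟩ := exists_isolating_interval hFfin hFp hFβ h2 h3
    obtain ⟨k1, k2, k3, k4⟩ := hlocal l tp r a1 a2 a3 (a4.trans h3) hpK a5
    obtain ⟨-, k6, -, k8⟩ := hlocal l' tq r' (h1.trans b1) b2 b3 b4 hqK b5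
    have hrr : tp < r' := h2.trans b3
    rw [hK] at k1 k2 k6
    have d1 := hbypass tp l r a1.le a2 a3 (a4.trans h3).le hpT (hK ▸ k1) (hK ▸ k2)
    have d2 := hbypass tp l r' a1.le a2 hrr b4.le hpT (hK ▸ k1) (hK ▸ k6)
    have d3 := hbypass tq r r' (h1.trans a3).le a4 b3 b4.le hqT (hK ▸ k2) (hK ▸ k6)
    rw [hK] at d1 d2 d3
    exact arc_has_two_sides hK' hγ hinj h0 ‹γ 1 ∈ K'› hends k1 k2 k6
      (k3.trans (hpq.trans k8.symm)) (k4.trans (hpq.trans k8.symm)) d1 d2 d3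
  obtain ⟨tp, hp1, hp2, rfl⟩ := hit p hp hpx hpy
  obtain ⟨tq, hq1, hq2, rfl⟩ := hit q hq hqx hqy
  rcases lt_trichotomy tp tq with h | h | h
  · exact main tp tq hp1 h hq2 hp hq hpK hqK hpqc
  · exact hpq (h ▸ rfl)
  · exact main tq tp hq1 h hp2 hq hp hqK hpK hpqc.symm

lemma ArcJoinedIn.exists_unit {X : Type*} [TopologicalSpace X] {S : Set X} {x y : X}
    (h : ArcJoinedIn S x y) (hxy : x ≠ y) :
    ∃ γ : ℝ → X, ContinuousOn γ (Icc 0 1) ∧ InjOn γ (Icc 0 1) ∧ γ 0 = x ∧ γ 1 = y ∧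
      MapsTo γ (Icc 0 1) S := by
  obtain ⟨δ, a, b, hab, hc, hi, h0, h1, hm⟩ := h
  have hlt : a < b := hab.lt_of_ne fun e => hxy (by rw [← h0, ← h1, e])
  have hmaps : MapsTo (fun t : ℝ => a + t * (b - a)) (Icc 0 1) (Icc a b) := fun t ht =>
    ⟨by nlinarith [ht.1], by nlinarith [ht.2]⟩
  refine ⟨fun t => δ (a + t * (b - a)), hc.comp (by fun_prop) hmaps, fun s hs t ht e => ?_,
    by simpa, by simpa, fun t ht => hm (hmaps ht)⟩
  have := hi (hmaps hs) (hmaps ht) e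
  have h3 : (s - t) * (b - a) = 0 := by linarith
  rcases mul_eq_zero.1 h3 with h | h <;> linarith

namespace Drawing

variable {V : Type} {G : SimpleGraph V}

lemma img_mk (Γ : Drawing G) (a b : V) : Γ.img s(a, b) = Γ.arc a b '' Icc 0 1 := rfl

lemma isCompact_img (Γ : Drawing G) {f : Sym2 V} (hf : f ∈ G.edgeSet) : IsCompact (Γ.img f) := by
  induction f using Sym2.ind with
  | _ a b => exact isCompact_Icc.image_of_continuousOn (Γ.arc_cont a b hf)

lemma vpos_mem_img (Γ : Drawing G) {f : Sym2 V} (hf : f ∈ G.edgeSet) {a : V} (ha : a ∈ f) :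
    Γ.vpos a ∈ Γ.img f := by
  obtain ⟨b, rfl⟩ := ha
  exact ⟨0, ⟨le_rfl, zero_le_one⟩, Γ.arc_start a b hf⟩

lemma mem_of_vpos_mem_img (Γ : Drawing G) {f : Sym2 V} (hf : f ∈ G.edgeSet) {a : V}
    (ha : Γ.vpos a ∈ Γ.img f) : a ∈ f := by
  induction f using Sym2.ind with
  | _ b c =>
    obtain ⟨t, ht, e⟩ := ha
    rcases eq_or_lt_of_le ht.1 with rfl | h0
    · rw [Γ.arc_start b c hf] at e
      simp [Γ.vpos_inj e]
    rcases eq_or_lt_of_le ht.2 with rfl | h1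
    · rw [Γ.arc_end b c hf] at e
      simp [Γ.vpos_inj e]
    · exact absurd ⟨a, e.symm⟩ (Γ.arc_avoids b c hf t ⟨h0, h1⟩)

lemma finite_img_inter (Γ : Drawing G) {f g : Sym2 V} (hf : f ∈ G.edgeSet) (hg : g ∈ G.edgeSet)
    (hfg : f ≠ g) : (Γ.img f ∩ Γ.img g).Finite := by
  induction f using Sym2.ind with
  | _ a b =>
    induction g using Sym2.ind with
    | _ c d => exact Γ.inter_finite a b c d hf hg hfg

lemma not_mem_three_img (Γ : Drawing G) {f g h : Sym2 V} (hf : f ∈ G.edgeSet)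
    (hg : g ∈ G.edgeSet) (hh : h ∈ G.edgeSet) (hfg : f ≠ g) (hfh : f ≠ h) (hgh : g ≠ h)
    {p : ℝ × ℝ} (hp : p ∉ range Γ.vpos) (h1 : p ∈ Γ.img f) (h2 : p ∈ Γ.img g)
    (h3 : p ∈ Γ.img h) : False := by
  induction f using Sym2.ind with
  | _ a b =>
    induction g using Sym2.ind with
    | _ c d =>
      induction h using Sym2.ind with
      | _ x y => exact Γ.no_triple_point p hp a b c d x y hf hg hh hfg hfh hgh ⟨h1, h2, h3⟩

lemma Crossing.symm {Γ : Drawing G} {f g : Sym2 V} {p : ℝ × ℝ} (h : Γ.Crossing f g p) :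
    Γ.Crossing g f p :=
  ⟨h.2.1, h.1, h.2.2.1.symm, h.2.2.2.2.1, h.2.2.2.1, h.2.2.2.2.2⟩

lemma finite_crossingSet [Finite V] (Γ : Drawing G) : Γ.crossingSet.Finite := by
  have : Γ.crossingSet ⊆ ⋃ f : Sym2 V, ⋃ g : Sym2 V, {p | Γ.Crossing f g p} := by
    rintro p ⟨f, g, h⟩
    simp only [mem_iUnion]
    exact ⟨f, g, h⟩
  refine Finite.subset (finite_iUnion fun f => finite_iUnion fun g => ?_) this
  by_cases h : f ∈ G.edgeSet ∧ g ∈ G.edgeSet ∧ f ≠ g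
  · exact (Γ.finite_img_inter h.1 h.2.1 h.2.2).subset fun p hp => ⟨hp.2.2.2.1, hp.2.2.2.2.1⟩
  · convert finite_empty
    ext p
    simp only [mem_empty_iff_false, iff_false]
    exact fun hp => h ⟨hp.1, hp.2.1, hp.2.2.1⟩

/-- An edge of a drawing can be redrawn along any arc that meets the other edges finitely often,
provided the other edges are pairwise non-crossing. -/
lemma exists_replace_arc (Γ : Drawing G) {u v : V} (huv : G.Adj u v) {γ : ℝ → ℝ × ℝ}
    (hγ : ContinuousOn γ (Icc 0 1)) (hinj : InjOn γ (Icc 0 1)) (h0 : γ 0 = Γ.vpos u)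
    (h1 : γ 1 = Γ.vpos v) (havoid : ∀ t ∈ Ioo (0 : ℝ) 1, γ t ∉ range Γ.vpos)
    (hfin : ∀ f ∈ G.edgeSet, f ≠ s(u, v) → (γ '' Icc 0 1 ∩ Γ.img f).Finite)
    (hplanar : ∀ f g p, Γ.Crossing f g p → f = s(u, v) ∨ g = s(u, v)) :
    ∃ Γ' : Drawing G, Γ'.vpos = Γ.vpos ∧ Γ'.img s(u, v) = γ '' Icc 0 1 ∧
      ∀ f ≠ s(u, v), Γ'.img f = Γ.img f := by
  classical
  have hne : u ≠ v := huv.ne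
  let A : V → V → ℝ → ℝ × ℝ := fun a b t =>
    if a = u ∧ b = v then γ t else if a = v ∧ b = u then γ (1 - t) else Γ.arc a b t
  have hA1 : A u v = γ := by ext1 t; simp [A]
  have hA2 : A v u = fun t => γ (1 - t) := by ext1 t; simp [A, hne, hne.symm]
  have hA3 : ∀ a b, s(a, b) ≠ s(u, v) → A a b = Γ.arc a b := by
    intro a b hab
    simp only [ne_eq, Sym2.eq_iff, not_or] at hab
    ext1 t
    simp [A, hab]
  have hcases : ∀ a b, (a = u ∧ b = v) ∨ (a = v ∧ b = u) ∨ s(a, b) ≠ s(u, v) := by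
    intro a b
    simp only [ne_eq, Sym2.eq_iff]
    tauto
  have hrev : MapsTo (fun t : ℝ => 1 - t) (Icc 0 1) (Icc 0 1) := fun t ht =>
    ⟨by linarith [ht.2], by linarith [ht.1]⟩
  have hrevimg : (fun t => γ (1 - t)) '' Icc 0 1 = γ '' Icc 0 1 := by
    ext p
    constructor
    · rintro ⟨t, ht, rfl⟩
      exact ⟨1 - t, hrev ht, rfl⟩
    · rintro ⟨t, ht, rfl⟩
      exact ⟨1 - t, hrev ht, by simp⟩
  have himg : ∀ a b, s(a, b) = s(u, v) → A a b '' Icc 0 1 = γ '' Icc 0 1 := by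
    intro a b hab
    rcases hcases a b with ⟨rfl, rfl⟩ | ⟨rfl, rfl⟩ | h
    · rw [hA1]
    · rw [hA2, hrevimg]
    · exact absurd hab h
  have hnocross : ∀ p, p ∉ range Γ.vpos → ∀ a b c d, G.Adj a b → G.Adj c d → s(a, b) ≠ s(c, d) →
      s(a, b) ≠ s(u, v) → s(c, d) ≠ s(u, v) → p ∈ A a b '' Icc 0 1 → p ∉ A c d '' Icc 0 1 := by
    intro p hp a b c d hab hcd hne h1 h2 h3 h4
    rw [hA3 _ _ h1] at h3
    rw [hA3 _ _ h2] at h4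
    exact (hplanar s(a, b) s(c, d) p ⟨hab, hcd, hne, h3, h4, hp⟩).elim h1 h2
  refine ⟨⟨Γ.vpos, Γ.vpos_inj, A, ?_, ?_, ?_, ?_, ?_, ?_, ?_, ?_⟩, rfl, ?_, ?_⟩
  · intro a b t
    rcases hcases a b with ⟨rfl, rfl⟩ | ⟨rfl, rfl⟩ | h
    · rw [hA1, hA2]; simp
    · rw [hA1, hA2]
    · rw [hA3 _ _ h, hA3 b a (by rwa [Sym2.eq_swap]), Γ.arc_symm]
  · intro a b hab
    rcases hcases a b with ⟨rfl, rfl⟩ | ⟨rfl, rfl⟩ | h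
    · rwa [hA1]
    · rw [hA2]; exact hγ.comp (by fun_prop) hrev
    · rw [hA3 _ _ h]; exact Γ.arc_cont a b hab
  · intro a b hab
    rcases hcases a b with ⟨rfl, rfl⟩ | ⟨rfl, rfl⟩ | h
    · rwa [hA1]
    · rw [hA2]
      intro s hs t ht e
      have := hinj (hrev hs) (hrev ht) e
      simpa using this
    · rw [hA3 _ _ h]; exact Γ.arc_injOn a b hab
  · intro a b hab
    rcases hcases a b with ⟨rfl, rfl⟩ | ⟨rfl, rfl⟩ | h
    · rwa [hA1]
    · rw [hA2]; simpa
    · rw [hA3 _ _ h]; exact Γ.arc_start a b hab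
  · intro a b hab
    rcases hcases a b with ⟨rfl, rfl⟩ | ⟨rfl, rfl⟩ | h
    · rwa [hA1]
    · rw [hA2]; simpa
    · rw [hA3 _ _ h]; exact Γ.arc_end a b hab
  · intro a b hab t ht
    rcases hcases a b with ⟨rfl, rfl⟩ | ⟨rfl, rfl⟩ | h
    · rw [hA1]; exact havoid t ht
    · rw [hA2]; exact havoid (1 - t) ⟨by linarith [ht.2], by linarith [ht.1]⟩
    · rw [hA3 _ _ h]; exact Γ.arc_avoids a b hab t ht
  · intro a b c d hab hcd hne
    by_cases h : s(a, b) = s(u, v)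
    · have h' : s(c, d) ≠ s(u, v) := fun e => hne (h.trans e.symm)
      rw [himg _ _ h, hA3 _ _ h']
      exact hfin s(c, d) hcd h'
    · by_cases h' : s(c, d) = s(u, v)
      · rw [himg _ _ h', hA3 _ _ h, inter_comm]
        exact hfin s(a, b) hab h
      · rw [hA3 _ _ h, hA3 _ _ h']
        exact Γ.inter_finite a b c d hab hcd hne
  · rintro p hp a b c d x y hab hcd hxy h1 h2 h3 ⟨p1, p2, p3⟩
    by_cases e1 : s(a, b) = s(u, v)
    · exact hnocross p hp c d x y hcd hxy h3 (fun e => h1 (e1.trans e.symm))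
        (fun e => h2 (e1.trans e.symm)) p2 p3
    · by_cases e2 : s(c, d) = s(u, v)
      · exact hnocross p hp a b x y hab hxy h2 e1 (fun e => h3 (e2.trans e.symm)) p1 p3
      · exact hnocross p hp a b c d hab hcd h1 e1 e2 p1 p2
  · exact himg u v rfl
  · intro f hf
    induction f using Sym2.ind with
    | _ a b =>
      change A a b '' Icc 0 1 = Γ.arc a b '' Icc 0 1
      rw [hA3 _ _ hf]

/-- If all crossings involve one edge, then that edge can be redrawn to cross each other edge at
most once. -/
theorem exists_crossings_le [Finite V] (Γ : Drawing G) {u v : V} (huv : G.Adj u v)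
    (hplanar : ∀ f g p, Γ.Crossing f g p → f = s(u, v) ∨ g = s(u, v)) :
    ∃ Γ' : Drawing G, Γ'.IsSkewness 1 ∧ Γ'.crossings ≤ (G.edgeSet \ {s(u, v)}).ncard := by
  classical
  set e : Sym2 V := s(u, v) with he
  have heE : e ∈ G.edgeSet := huv
  let KK : Set (Sym2 V) → Set (ℝ × ℝ) := fun F => (⋃ f ∈ F, Γ.img f) ∪ range Γ.vpos
  have hKK : ∀ F ⊆ G.edgeSet, IsCompact (KK F) := fun F hF =>
    ((toFinite F).isCompact_biUnion fun f hf => Γ.isCompact_img (hF hf)).union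
      (finite_range _).isCompact
  set E : Set (Sym2 V) := G.edgeSet \ {e} with hE
  set K := KK E with hKdef
  have hEsub : E ⊆ G.edgeSet := sdiff_subset
  have hne : Γ.vpos u ≠ Γ.vpos v := fun h => huv.ne (Γ.vpos_inj h)
  have hends : ∀ p ∈ Γ.img e, p ∈ range Γ.vpos → p ∈ ({Γ.vpos u, Γ.vpos v} : Set (ℝ × ℝ)) := by
    rintro _ hp ⟨a, rfl⟩
    have := Γ.mem_of_vpos_mem_img heE hp
    rw [he, Sym2.mem_iff] at this
    rcases this with rfl | rfl <;> simp
  have hT₀fin : ((Γ.img e ∩ K) \ {Γ.vpos u, Γ.vpos v}).Finite := by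
    refine Finite.subset (s := ⋃ f ∈ E, Γ.img e ∩ Γ.img f)
      ((toFinite E).biUnion fun f hf => Γ.finite_img_inter heE hf.1 (Ne.symm hf.2)) ?_
    rintro p ⟨⟨hpe, hp | hp⟩, hpn⟩
    · simp only [mem_iUnion] at hp ⊢
      obtain ⟨f, hf, hp⟩ := hp
      exact ⟨f, hf, hpe, hp⟩
    · exact absurd (hends p hpe hp) hpn
  have hjoin : ArcJoinedIn (Kᶜ ∪ {Γ.vpos u, Γ.vpos v} ∪ hT₀fin.toFinset) (Γ.vpos u) (Γ.vpos v) := by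
    refine ⟨Γ.arc u v, 0, 1, zero_le_one, Γ.arc_cont u v huv, Γ.arc_injOn u v huv,
      Γ.arc_start u v huv, Γ.arc_end u v huv, fun t ht => ?_⟩
    by_cases h1 : Γ.arc u v t ∈ K
    · by_cases h2 : Γ.arc u v t ∈ ({Γ.vpos u, Γ.vpos v} : Set (ℝ × ℝ))
      · exact Or.inl (Or.inr h2)
      · exact Or.inr (by simpa using ⟨⟨⟨t, ht, rfl⟩, h1⟩, by simpa using h2⟩)
    · exact Or.inl (Or.inl h1)
  obtain ⟨T, hTT, hTj, hTmin⟩ := ArcJoinedIn.exists_minimal _ hjoin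
  have hTprop : ∀ p ∈ T, p ∈ Γ.img e ∧ p ∉ range Γ.vpos ∧ ∃ f ∈ E, p ∈ Γ.img f := by
    intro p hp
    have := hTT hp
    rw [Finite.mem_toFinset] at this
    obtain ⟨⟨hpe, hpK⟩, hpn⟩ := this
    have hr : p ∉ range Γ.vpos := fun h => hpn (hends p hpe h)
    refine ⟨hpe, hr, ?_⟩
    rcases hpK with hpK | hpK
    · simpa only [mem_iUnion, exists_prop] using hpK
    · exact absurd hpK hr
  have : Nonempty (Sym2 V) := ⟨e⟩
  choose! F hFE hF using fun p hp => (hTprop p hp).2.2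
  have honce : InjOn F (T : Set (ℝ × ℝ)) := by
    intro p hp q hq hpq
    by_contra hne'
    have hf := hFE p hp
    have hp' := hF p hp
    have hq' := hF q hq
    rw [← hpq] at hq'
    generalize F p = f at hf hp' hq'
    induction f using Sym2.ind with
    | _ a b =>
      have hab : G.Adj a b := hf.1
      have hK'off : ∀ r ∈ Γ.img s(a, b), r ∈ KK (E \ {s(a, b)}) → r ∈ range Γ.vpos := by
        intro r hr hrK
        rcases hrK with hrK | hrK
        · by_contra hrv
          simp only [mem_iUnion, exists_prop] at hrK
          obtain ⟨g, hg, hrg⟩ := hrK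
          rcases hplanar s(a, b) g r ⟨hab, hg.1.1, Ne.symm hg.2, hr, hrg, hrv⟩ with h | h
          · exact hf.2 h
          · exact hg.1.2 h
        · exact hrK
      refine minimal_arc_meets_once (K := K) (K' := KK (E \ {s(a, b)}))
        (hKK _ (sdiff_subset.trans hEsub)) (Γ.arc_cont a b hab) (Γ.arc_injOn a b hab)
        ?_ ?_ ?_ ?_ hTj hTmin hp hq hne' ?_ ?_ ?_ ?_ hp' hq' ?_ ?_
      · exact Or.inr ⟨a, (Γ.arc_start a b hab).symm⟩
      · exact Or.inr ⟨b, (Γ.arc_end a b hab).symm⟩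
      · rintro r ⟨hrK, hr⟩
        obtain ⟨c, rfl⟩ := hK'off r hr hrK
        have := Γ.mem_of_vpos_mem_img (f := s(a, b)) hab hr
        rw [Γ.arc_start a b hab, Γ.arc_end a b hab]
        rw [Sym2.mem_iff] at this
        rcases this with rfl | rfl <;> simp
      · rw [← Γ.img_mk]
        ext r
        simp only [hKdef, KK, mem_union, mem_iUnion, exists_prop]
        constructor
        · rintro (⟨g, hg, hr⟩ | hr)
          · by_cases h : g = s(a, b)
            · subst h; exact Or.inr hr
            · exact Or.inl (Or.inl ⟨g, ⟨hg, h⟩, hr⟩)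
          · exact Or.inl (Or.inr hr)
        · rintro ((⟨g, hg, hr⟩ | hr) | hr)
          · exact Or.inl ⟨g, hg.1, hr⟩
          · exact Or.inr hr
          · exact Or.inl ⟨_, hf, hr⟩
      · rintro rfl; exact (hTprop _ hp).2.1 ⟨u, rfl⟩
      · rintro rfl; exact (hTprop _ hp).2.1 ⟨v, rfl⟩
      · rintro rfl; exact (hTprop _ hq).2.1 ⟨u, rfl⟩
      · rintro rfl; exact (hTprop _ hq).2.1 ⟨v, rfl⟩
      · exact fun h => (hTprop _ hp).2.1 (hK'off _ hp' h)
      · exact fun h => (hTprop _ hq).2.1 (hK'off _ hq' h)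
  have hTcard : T.card ≤ E.ncard := by
    rw [← ncard_coe_finset]
    exact ncard_le_ncard_of_injOn F (fun p hp => hFE p hp) honce (toFinite E)
  obtain ⟨γ, hγ, hγi, h0, h1, hm⟩ := hTj.exists_unit hne
  have hγK : ∀ t ∈ Icc (0 : ℝ) 1, γ t ∈ K → γ t ∉ range Γ.vpos → γ t ∈ T := by
    intro t ht hK hr
    rcases hm ht with (h | h | h) | h
    · exact absurd hK h
    · exact absurd ⟨u, h.symm⟩ hr
    · exact absurd ⟨v, h.symm⟩ hr
    · exact h
  have hKT : γ '' Icc 0 1 ∩ K ⊆ {Γ.vpos u, Γ.vpos v} ∪ T := by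
    rintro _ ⟨⟨t, ht, rfl⟩, h⟩
    rcases hm ht with (h' | h') | h'
    · exact absurd h h'
    · exact Or.inl h'
    · exact Or.inr h'
  have havoid : ∀ t ∈ Ioo (0 : ℝ) 1, γ t ∉ range Γ.vpos := by
    intro t ht hr
    have htI := Ioo_subset_Icc_self ht
    rcases hKT ⟨⟨t, htI, rfl⟩, Or.inr hr⟩ with (h | h) | h
    · exact ht.1.ne' (hγi htI ⟨le_rfl, zero_le_one⟩ (h.trans h0.symm))
    · exact ht.2.ne (hγi htI ⟨zero_le_one, le_rfl⟩ (h.trans h1.symm))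
    · exact (hTprop _ h).2.1 hr
  have hfin : ∀ f ∈ G.edgeSet, f ≠ s(u, v) → (γ '' Icc 0 1 ∩ Γ.img f).Finite := by
    intro f hf hfe
    refine Finite.subset (Finite.union (by simp) T.finite_toSet) (subset_trans ?_ hKT)
    refine inter_subset_inter_right _ fun p hp => Or.inl ?_
    simp only [mem_iUnion, exists_prop]
    exact ⟨f, ⟨hf, hfe⟩, hp⟩
  obtain ⟨Γ', hpos, himg, himg'⟩ := Γ.exists_replace_arc huv hγ hγi h0 h1 havoid hfin hplanar
  have hcr : ∀ f g p, Γ'.Crossing f g p → p ∈ T ∧ (f = e ∨ g = e) := by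
    have aux : ∀ g p, Γ'.Crossing e g p → p ∈ T := by
      rintro g p ⟨h1, h2, h3, h4, h5, h6⟩
      rw [himg] at h4
      rw [himg' g h3.symm] at h5
      rw [hpos] at h6
      obtain ⟨t, ht, rfl⟩ := h4
      refine hγK t ht (Or.inl ?_) h6
      simp only [mem_iUnion, exists_prop]
      exact ⟨g, ⟨h2, h3.symm⟩, h5⟩
    intro f g p h
    by_cases hf : f = e
    · subst hf
      exact ⟨aux g p h, Or.inl rfl⟩
    by_cases hg : g = e
    · subst hg
      exact ⟨aux f p h.symm, Or.inr rfl⟩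
    obtain ⟨h1, h2, h3, h4, h5, h6⟩ := h
    rw [himg' _ hf] at h4
    rw [himg' _ hg] at h5
    rw [hpos] at h6
    exact ((hplanar f g p ⟨h1, h2, h3, h4, h5, h6⟩).elim hf hg).elim
  refine ⟨Γ', ⟨{e}, by simp, ?_⟩, ?_⟩
  · rintro p ⟨f, g, h⟩
    rcases (hcr f g p h).2 with rfl | rfl
    · exact ⟨_, by simp, g, h⟩
    · exact ⟨_, by simp, f, h.symm⟩
  · refine le_trans ?_ hTcard
    rw [← ncard_coe_finset]
    exact ncard_le_ncard (fun p ⟨f, g, h⟩ => (hcr f g p h).1) T.finite_toSet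

end Drawing

lemma log_change_eq {g h : ℝ → ℂ} (hg : Continuous g) (hh : Continuous h) {c : ℂ}
    (hc : c ≠ 0) (e : ∀ t, Complex.exp (h t) = c * Complex.exp (g t)) : h 1 - h 0 = g 1 - g 0 := by
  have := eq_of_exp_eq_one (s := univ) isPreconnected_univ
    (g := fun t => h t - g t - Complex.log c)
    ((hh.sub hg).sub continuous_const).continuousOn ?_ (mem_univ 1) (mem_univ 0)
  · linear_combination this
  · intro t _
    rw [Complex.exp_sub, Complex.exp_sub, e, Complex.exp_log hc]
    field_simp [Complex.exp_ne_zero]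

/-- The changes of logarithm along the sides of a square sum up to zero. -/
lemma log_change_square {γ δ : ℝ → ℂ} (hγ : Continuous γ) (hδ : Continuous δ)
    (hne : ∀ s t, γ s ≠ δ t) {g₀ g₁ h₀ h₁ : ℝ → ℂ} (cg₀ : Continuous g₀) (cg₁ : Continuous g₁)
    (ch₀ : Continuous h₀) (ch₁ : Continuous h₁) (eg₀ : ∀ s, Complex.exp (g₀ s) = γ s - δ 0)
    (eg₁ : ∀ s, Complex.exp (g₁ s) = γ s - δ 1) (eh₀ : ∀ t, Complex.exp (h₀ t) = δ t - γ 0)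
    (eh₁ : ∀ t, Complex.exp (h₁ t) = δ t - γ 1) :
    (g₀ 1 - g₀ 0) + (h₁ 1 - h₁ 0) - (g₁ 1 - g₁ 0) - (h₀ 1 - h₀ 0) = 0 := by
  obtain ⟨L, hL, eL⟩ := exists_continuous_log (A := ℝ × ℝ) (f := fun p => γ p.1 - δ p.2)
    (by fun_prop) (fun p => sub_ne_zero.2 (hne _ _))
  have k0 := log_change_eq (h := fun s => L (s, 0)) (c := 1) cg₀ (by fun_prop) one_ne_zero
    (fun s => by rw [eL, eg₀, one_mul])
  have k1 := log_change_eq (h := fun s => L (s, 1)) (c := 1) cg₁ (by fun_prop) one_ne_zero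
    (fun s => by rw [eL, eg₁, one_mul])
  have k2 := log_change_eq (h := fun t => L (0, t)) (c := -1) ch₀ (by fun_prop) (by simp)
    (fun s => by rw [eL, eh₀]; ring)
  have k3 := log_change_eq (h := fun t => L (1, t)) (c := -1) ch₁ (by fun_prop) (by simp)
    (fun s => by rw [eL, eh₁]; ring)
  linear_combination -k0 + k1 + k2 - k3

/-- There is no way of joining five points of the plane pairwise so that independent connections
are disjoint. -/
theorem no_disjoint_K5 {P : Fin 5 → ℝ × ℝ} {F : Fin 5 → Fin 5 → Set (ℝ × ℝ)}
    (hF : ∀ i j, i < j → JoinedIn (F i j) (P i) (P j))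
    (hd : ∀ a b c d, a < b → c < d → a ≠ c → a ≠ d → b ≠ c → b ≠ d → Disjoint (F a b) (F c d)) :
    False := by
  set p : Fin 5 → ℂ := fun i => toC (P i) with hp
  have hγ : ∀ i j, ∃ γ : ℝ → ℂ, i < j → Continuous γ ∧ γ 0 = p i ∧ γ 1 = p j ∧
      ∀ t, γ t ∈ toC '' F i j := by
    intro i j
    by_cases h : i < j
    · obtain ⟨γ, hm⟩ := hF i j h
      refine ⟨fun t => toC (γ.extend t), fun _ => ⟨continuous_toC.comp γ.continuous_extend,
        by simp [hp], by simp [hp], fun t => ⟨_, hm (projIcc 0 1 zero_le_one t), rfl⟩⟩⟩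
    · exact ⟨0, fun h' => absurd h' h⟩
  choose γ hγ using hγ
  have hmem : ∀ i k, i ≠ k → P i ∈ F (min i k) (max i k) := by
    intro i k hik
    rcases lt_or_gt_of_ne hik with h | h
    · rw [min_eq_left h.le, max_eq_right h.le]
      exact (hF _ _ h).source_mem
    · rw [min_eq_right h.le, max_eq_left h.le]
      exact (hF _ _ h).target_mem
  have havoid : ∀ a b i, a < b → i ≠ a → i ≠ b → P i ∉ F a b := by
    intro a b i hab hia hib hi
    obtain ⟨k, hka, hkb, hki⟩ : ∃ k : Fin 5, k ≠ a ∧ k ≠ b ∧ k ≠ i := by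
      clear * -; revert a b i; decide
    refine disjoint_left.1 (hd a b (min i k) (max i k) hab (by simpa using hki) ?_ ?_ ?_ ?_) hi
      (hmem i k hki.symm)
    · rcases min_choice i k with h | h <;> rw [h] <;> [exact hia.symm; exact hka.symm]
    · rcases max_choice i k with h | h <;> rw [h] <;> [exact hia.symm; exact hka.symm]
    · rcases min_choice i k with h | h <;> rw [h] <;> [exact hib.symm; exact hkb.symm]
    · rcases max_choice i k with h | h <;> rw [h] <;> [exact hib.symm; exact hkb.symm]
  have hinj : ∀ i j, i ≠ j → p i - p j ≠ 0 := by
    intro i j hij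
    refine toC_sub_ne_zero fun e => ?_
    obtain ⟨k, hki, hkj⟩ : ∃ k : Fin 5, k ≠ i ∧ k ≠ j := by
      clear * -; revert i j; decide
    refine havoid (min j k) (max j k) i (by simpa using hkj) ?_ ?_ (e ▸ hmem j k hkj.symm)
    · rcases min_choice j k with h | h <;> rw [h] <;> [exact hij; exact hki.symm]
    · rcases max_choice j k with h | h <;> rw [h] <;> [exact hij; exact hki.symm]
  have hg : ∀ a b v, ∃ g : ℝ → ℂ, a < b → v ≠ a → v ≠ b → Continuous g ∧
      ∀ t, Complex.exp (g t) = γ a b t - p v := by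
    intro a b v
    by_cases h : a < b ∧ v ≠ a ∧ v ≠ b
    · obtain ⟨hab, hva, hvb⟩ := h
      obtain ⟨h1, h2, h3, h4⟩ := hγ a b hab
      have hne : ∀ t, γ a b t - p v ≠ 0 := by
        intro t e
        obtain ⟨z, hz, ez⟩ := h4 t
        rw [← ez] at e
        have := toC_injective (sub_eq_zero.1 e)
        exact havoid a b v hab hva hvb (this ▸ hz)
      obtain ⟨g, hg, eg⟩ := exists_continuous_log (f := fun t => γ a b t - p v) (by fun_prop) hne
      exact ⟨g, fun _ _ _ => ⟨hg, eg⟩⟩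
    · exact ⟨0, fun h1 h2 h3 => absurd ⟨h1, h2, h3⟩ h⟩
  choose g hg using hg
  set lam : Fin 5 → Fin 5 → ℂ := fun x y =>
    if x < y then Complex.log (p x - p y) else Complex.log (p y - p x) + Real.pi * Complex.I
    with hlam
  have hlamexp : ∀ x y, x ≠ y → Complex.exp (lam x y) = p x - p y := by
    intro x y hxy
    by_cases h : x < y
    · simp only [hlam, h, if_true]
      exact Complex.exp_log (hinj x y hxy)
    · simp only [hlam, h, if_false]
      rw [Complex.exp_add, Complex.exp_log (hinj y x hxy.symm), Complex.exp_pi_mul_I]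
      ring
  set σ : Fin 5 → Fin 5 → ℤ := fun x y => if x < y then -1 else 1 with hσ
  have hlamσ : ∀ x y, x ≠ y → lam x y - lam y x = σ x y * (Real.pi * Complex.I) := by
    intro x y hxy
    rcases lt_or_gt_of_ne hxy with h | h
    · simp [hlam, hσ, h, h.not_gt]
    · simp [hlam, hσ, h, h.not_gt]
  have hn : ∀ a b v, ∃ n : ℤ, a < b → v ≠ a → v ≠ b →
      g a b v 1 - g a b v 0 = lam b v - lam a v + n * (2 * Real.pi * Complex.I) := by
    intro a b v
    by_cases h : a < b ∧ v ≠ a ∧ v ≠ b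
    · obtain ⟨hab, hva, hvb⟩ := h
      obtain ⟨n, hn⟩ := Complex.exp_eq_exp_iff_exists_int.1
        (show Complex.exp (g a b v 1 - g a b v 0) = Complex.exp (lam b v - lam a v) by
          rw [Complex.exp_sub, Complex.exp_sub, (hg a b v hab hva hvb).2,
            (hg a b v hab hva hvb).2, (hγ a b hab).2.1, (hγ a b hab).2.2.1,
            hlamexp _ _ hvb.symm, hlamexp _ _ hva.symm])
      exact ⟨n, fun _ _ _ => hn⟩
    · exact ⟨0, fun h1 h2 h3 => absurd ⟨h1, h2, h3⟩ h⟩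
  choose n hn using hn
  have key : ∀ a b c d, a < b → c < d → a ≠ c → a ≠ d → b ≠ c → b ≠ d →
      σ b c + σ c a + σ a d + σ d b + 2 * (n a b c + n c d b - n a b d - n c d a) = 0 := by
    intro a b c d hab hcd hac had hbc hbd
    obtain ⟨c1, s1, e1, m1⟩ := hγ a b hab
    obtain ⟨c2, s2, e2, m2⟩ := hγ c d hcd
    have hsq := log_change_square c1 c2 ?_
      (hg a b c hab hac.symm hbc.symm).1 (hg a b d hab had.symm hbd.symm).1
      (hg c d a hcd hac had).1 (hg c d b hcd hbc hbd).1
      (by rw [s2]; exact (hg a b c hab hac.symm hbc.symm).2)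
      (by rw [e2]; exact (hg a b d hab had.symm hbd.symm).2)
      (by rw [s1]; exact (hg c d a hcd hac had).2)
      (by rw [e1]; exact (hg c d b hcd hbc hbd).2)
    · rw [hn a b c hab hac.symm hbc.symm, hn a b d hab had.symm hbd.symm, hn c d a hcd hac had,
        hn c d b hcd hbc hbd] at hsq
      have h1 := hlamσ b c hbc
      have h2 := hlamσ c a hac.symm
      have h3 := hlamσ a d had
      have h4 := hlamσ d b hbd.symm
      have hpi : (Real.pi * Complex.I : ℂ) ≠ 0 := by simp [Real.pi_ne_zero]
      have : ((σ b c + σ c a + σ a d + σ d b + 2 * (n a b c + n c d b - n a b d - n c d a) : ℤ) : ℂ)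
          * (Real.pi * Complex.I) = 0 := by
        push_cast
        linear_combination hsq - h1 - h2 - h3 - h4
      exact_mod_cast (mul_eq_zero.1 this).resolve_right hpi
    · intro s t e
      obtain ⟨z, hz, ez⟩ := m1 s
      obtain ⟨w, hw, ew⟩ := m2 t
      rw [← ez, ← ew] at e
      exact disjoint_left.1 (hd a b c d hab hcd hac had hbc hbd) hz (toC_injective e ▸ hw)
  have k1 := key 0 1 2 3 (by decide) (by decide) (by decide) (by decide) (by decide) (by decide)
  have k2 := key 0 1 2 4 (by decide) (by decide) (by decide) (by decide) (by decide) (by decide)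
  have k3 := key 0 1 3 4 (by decide) (by decide) (by decide) (by decide) (by decide) (by decide)
  have k4 := key 0 2 1 3 (by decide) (by decide) (by decide) (by decide) (by decide) (by decide)
  have k5 := key 0 2 1 4 (by decide) (by decide) (by decide) (by decide) (by decide) (by decide)
  have k6 := key 0 2 3 4 (by decide) (by decide) (by decide) (by decide) (by decide) (by decide)
  have k7 := key 0 3 1 2 (by decide) (by decide) (by decide) (by decide) (by decide) (by decide)
  have k8 := key 0 3 1 4 (by decide) (by decide) (by decide) (by decide) (by decide) (by decide)
  have k9 := key 0 3 2 4 (by decide) (by decide) (by decide) (by decide) (by decide) (by decide)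
  have k10 := key 0 4 1 2 (by decide) (by decide) (by decide) (by decide) (by decide) (by decide)
  have k11 := key 0 4 1 3 (by decide) (by decide) (by decide) (by decide) (by decide) (by decide)
  have k12 := key 0 4 2 3 (by decide) (by decide) (by decide) (by decide) (by decide) (by decide)
  have k13 := key 1 2 3 4 (by decide) (by decide) (by decide) (by decide) (by decide) (by decide)
  have k14 := key 1 3 2 4 (by decide) (by decide) (by decide) (by decide) (by decide) (by decide)
  have k15 := key 1 4 2 3 (by decide) (by decide) (by decide) (by decide) (by decide) (by decide)
  simp [hσ] at k1 k2 k3 k4 k5 k6 k7 k8 k9 k10 k11 k12 k13 k14 k15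
  omega

namespace Drawing

variable {V : Type} {G : SimpleGraph V}

lemma joinedIn_walk (Γ : Drawing G) {x y : V} (W : G.Walk x y) :
    JoinedIn ({p | ∃ z ∈ W.support, p = Γ.vpos z} ∪ {p | ∃ f ∈ W.edges, p ∈ Γ.img f})
      (Γ.vpos x) (Γ.vpos y) := by
  induction W with
  | nil => exact JoinedIn.refl (Or.inl ⟨_, by simp, rfl⟩)
  | @cons u v w h W ih =>
    refine JoinedIn.trans (y := Γ.vpos v) ?_ (ih.mono ?_)
    · have hc : IsPathConnected (Γ.img s(u, v)) :=
        ((convex_Icc (0 : ℝ) 1).isPathConnected ⟨0, by simp⟩).image' (Γ.arc_cont u v h)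
      refine (hc.joinedIn _ (Γ.vpos_mem_img h (by simp)) _
        (Γ.vpos_mem_img h (by simp))).mono fun p hp => Or.inr ⟨_, by simp, hp⟩
    · rintro p (⟨z, hz, e⟩ | ⟨f, hf, e⟩)
      · exact Or.inl ⟨z, by simp [hz], e⟩
      · exact Or.inr ⟨f, by simp [hf], e⟩

/-- A subdivision of `K₅`, given by walks between five vertices, has a pair of independent
subdivided edges that cross. -/
theorem exists_crosses_of_walks (Γ : Drawing G) (P : Fin 5 → V) (W : ∀ i j, G.Walk (P i) (P j))
    (hW : ∀ a b c d, a < b → c < d → a ≠ c → a ≠ d → b ≠ c → b ≠ d →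
      ∀ x ∈ (W a b).support, x ∉ (W c d).support) :
    ∃ a b c d, a < b ∧ c < d ∧ a ≠ c ∧ a ≠ d ∧ b ≠ c ∧ b ≠ d ∧
      ∃ f ∈ (W a b).edges, ∃ g ∈ (W c d).edges, Γ.Crosses f g := by
  by_contra hno
  refine no_disjoint_K5 (fun i j _ => Γ.joinedIn_walk (W i j)) ?_
  intro a b c d hab hcd hac had hbc hbd
  have hdis := hW a b c d hab hcd hac had hbc hbd
  have hvertex : ∀ {x y : V} (W : G.Walk x y) z f, f ∈ W.edges → Γ.vpos z ∈ Γ.img f →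
      z ∈ W.support := by
    intro x y W z f hf hz
    have := Γ.mem_of_vpos_mem_img (W.edges_subset_edgeSet hf) hz
    exact W.mem_support_of_mem_edges hf this
  rw [disjoint_left]
  rintro p (⟨z, hz, rfl⟩ | ⟨f, hf, hpf⟩) (⟨z', hz', e⟩ | ⟨g, hg, hpg⟩)
  · rw [Γ.vpos_inj e] at hz
    exact hdis _ hz hz'
  · exact hdis _ hz (hvertex _ _ _ hg hpg)
  · subst e
    exact hdis _ (hvertex _ _ _ hf hpf) hz'
  · by_cases hp : p ∈ range Γ.vpos
    · obtain ⟨z, rfl⟩ := hp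
      exact hdis _ (hvertex _ _ _ hf hpf) (hvertex _ _ _ hg hpg)
    · refine hno ⟨a, b, c, d, hab, hcd, hac, had, hbc, hbd, f, hf, g, hg, p,
        (W a b).edges_subset_edgeSet hf, (W c d).edges_subset_edgeSet hg, ?_, hpf, hpg, hp⟩
      rintro rfl
      induction f using Sym2.ind with
      | _ x y =>
        exact hdis x ((W a b).fst_mem_support_of_mem_edges hf)
          ((W c d).fst_mem_support_of_mem_edges hg)

end Drawing

namespace SimpleGraph

variable {V : Type*}

/-- `x` and `y` are joined by a walk of `G` inside `S`. -/
def LinkedIn (G : SimpleGraph V) (S : Set V) : V → V → Prop :=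
  Relation.ReflTransGen fun a b => G.Adj a b ∧ a ∈ S ∧ b ∈ S

lemma LinkedIn.exists_walk {G : SimpleGraph V} {S : Set V} {a b : V} (h : G.LinkedIn S a b)
    (ha : a ∈ S) : ∃ W : G.Walk a b, ∀ z ∈ W.support, z ∈ S := by
  induction h with
  | refl => exact ⟨Walk.nil, by simpa⟩
  | tail _ hbc ih =>
    obtain ⟨W, hW⟩ := ih
    refine ⟨W.concat hbc.1, fun z hz => ?_⟩
    rw [Walk.support_concat] at hz
    simp only [List.mem_append, List.mem_singleton] at hz
    rcases hz with hz | rfl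
    · exact hW z hz
    · exact hbc.2.2

/-- A model of the complete graph on `k` vertices as a minor of `G`, with branch sets inside
`S`. -/
def HasCliqueModel (G : SimpleGraph V) (S : Finset V) (k : ℕ) : Prop :=
  ∃ B : Fin k → Set V, (∀ i, B i ⊆ S) ∧ (∀ i, (B i).Nonempty) ∧
    (∀ i, ∀ a ∈ B i, ∀ b ∈ B i, G.LinkedIn (B i) a b) ∧ (∀ i j, i ≠ j → Disjoint (B i) (B j)) ∧
    ∀ i j, i ≠ j → ∃ a ∈ B i, ∃ b ∈ B j, G.Adj a b

/-- The graph obtained by contracting `y` into `x` (keeping `y` as a vertex). -/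
def contractInto (G : SimpleGraph V) (x y : V) : SimpleGraph V where
  Adj a b := a ≠ b ∧ (G.Adj a b ∨ (a = x ∧ G.Adj y b) ∨ (b = x ∧ G.Adj y a))
  symm := ⟨by
    rintro a b ⟨h1, h2⟩
    refine ⟨h1.symm, ?_⟩
    rw [G.adj_comm b a]
    tauto⟩
  loopless := ⟨fun a h => h.1 rfl⟩

lemma HasCliqueModel.of_contractInto [DecidableEq V] {G : SimpleGraph V} {S : Finset V} {k : ℕ}
    {x y : V} (hxy : G.Adj x y) (hy : y ∈ S)
    (h : (G.contractInto x y).HasCliqueModel (S.erase y) k) : G.HasCliqueModel S k := by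
  obtain ⟨B, hBS, hne, hconn, hdis, hadj⟩ := h
  have hyB : ∀ i, y ∉ B i := fun i h => by simpa using hBS i h
  let C : Fin k → Set V := fun i => {v | v ∈ B i ∨ (v = y ∧ x ∈ B i)}
  have hBC : ∀ i, B i ⊆ C i := fun i v hv => Or.inl hv
  have hstep : ∀ i a b, (G.contractInto x y).Adj a b → a ∈ B i → b ∈ B i →
      G.LinkedIn (C i) a b := by
    rintro i a b ⟨-, h | ⟨rfl, h⟩ | ⟨rfl, h⟩⟩ ha hb
    · exact .single ⟨h, hBC i ha, hBC i hb⟩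
    · exact .tail (.single ⟨hxy, hBC i ha, Or.inr ⟨rfl, ha⟩⟩) ⟨h, Or.inr ⟨rfl, ha⟩, hBC i hb⟩
    · exact .tail (.single ⟨h.symm, hBC i ha, Or.inr ⟨rfl, hb⟩⟩)
        ⟨hxy.symm, Or.inr ⟨rfl, hb⟩, hBC i hb⟩
  have hlink : ∀ i, ∀ a ∈ B i, ∀ b ∈ B i, G.LinkedIn (C i) a b := by
    intro i a ha b hb
    have := hconn i a ha b hb
    clear hb
    induction this with
    | refl => exact .refl
    | tail _ h ih => exact ih.trans (hstep i _ _ h.1 h.2.1 h.2.2)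
  refine ⟨C, ?_, fun i => (hne i).mono (hBC i), ?_, ?_, ?_⟩
  · rintro i v (hv | ⟨rfl, -⟩)
    · exact Finset.mem_of_mem_erase (hBS i hv)
    · exact hy
  · rintro i a ha b hb
    have hin : ∀ a ∈ C i, ∃ a' ∈ B i, G.LinkedIn (C i) a a' ∧ G.LinkedIn (C i) a' a := by
      rintro a (ha' | ⟨e, hxi⟩)
      · exact ⟨a, ha', .refl, .refl⟩
      · subst e
        exact ⟨x, hxi, .single ⟨hxy.symm, Or.inr ⟨rfl, hxi⟩, hBC i hxi⟩,
          .single ⟨hxy, hBC i hxi, Or.inr ⟨rfl, hxi⟩⟩⟩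
    obtain ⟨a', ha', h1, -⟩ := hin a ha
    obtain ⟨b', hb', -, h2⟩ := hin b hb
    exact (h1.trans (hlink i a' ha' b' hb')).trans h2
  · intro i j hij
    have := hdis i j hij
    rw [Set.disjoint_left] at this ⊢
    rintro a (ha | ⟨rfl, ha⟩) (hb | ⟨e, hb⟩)
    · exact this ha hb
    · subst e; exact hyB i ha
    · exact hyB j hb
    · exact this ha hb
  · intro i j hij
    obtain ⟨a, ha, b, hb, -, h | ⟨rfl, h⟩ | ⟨rfl, h⟩⟩ := hadj i j hij
    · exact ⟨a, hBC i ha, b, hBC j hb, h⟩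
    · exact ⟨y, Or.inr ⟨rfl, ha⟩, b, hBC j hb, h⟩
    · exact ⟨a, hBC i ha, y, Or.inr ⟨rfl, hb⟩, h.symm⟩

lemma HasCliqueModel.succ_of_neighbors {G : SimpleGraph V} {S T : Finset V} {k : ℕ}
    {x : V} (hx : x ∈ S) (hTS : T ⊆ S) (hT : ∀ y ∈ T, G.Adj x y) (h : G.HasCliqueModel T k) :
    G.HasCliqueModel S (k + 1) := by
  obtain ⟨B, hBS, hne, hconn, hdis, hadj⟩ := h
  have hxB : ∀ i, x ∉ B i := fun i h => G.loopless.irrefl x (hT x (hBS i h))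
  have hxadj : ∀ i, ∃ b ∈ B i, G.Adj x b := fun i =>
    let ⟨b, hb⟩ := hne i; ⟨b, hb, hT b (hBS i hb)⟩
  refine ⟨Fin.cons {x} B, ?_, ?_, ?_, ?_, ?_⟩
  · refine Fin.cases (by simpa) fun i => ?_
    simpa using (hBS i).trans hTS
  · refine Fin.cases (by simp) fun i => by simpa using hne i
  · refine Fin.cases ?_ fun i => by simpa using hconn i
    simp only [Fin.cons_zero, mem_singleton_iff]
    rintro a rfl b rfl
    exact .refl
  · refine Fin.cases (Fin.cases (by simp) fun j _ => ?_) fun i => Fin.cases (fun _ => ?_)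
      fun j hij => ?_
    · simpa using hxB j
    · simpa using hxB i
    · simpa using hdis i j (by simpa using hij)
  · refine Fin.cases (Fin.cases (by simp) fun j _ => ?_) fun i => Fin.cases (fun _ => ?_)
      fun j hij => ?_
    · simpa using hxadj j
    · simpa [G.adj_comm] using hxadj i
    · simpa using hadj i j (by simpa using hij)

open scoped Classical in
/-- The set of ordered pairs of adjacent vertices in `S`. -/
def adjPairs (G : SimpleGraph V) (S : Finset V) : Finset (V × V) :=
  (S ×ˢ S).filter fun p => G.Adj p.1 p.2

lemma mem_adjPairs {G : SimpleGraph V} {S : Finset V} {p : V × V} :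
    p ∈ G.adjPairs S ↔ p.1 ∈ S ∧ p.2 ∈ S ∧ G.Adj p.1 p.2 := by
  simp [adjPairs, and_assoc]

open scoped Classical in
lemma card_adjPairs_le_contractInto {G : SimpleGraph V} {S : Finset V} {x y : V} (hx : x ∈ S)
    (hxy : G.Adj x y) :
    (G.adjPairs S).card ≤ ((G.contractInto x y).adjPairs (S.erase y)).card + 2 +
      2 * (S.filter fun z => G.Adj x z ∧ G.Adj y z).card := by
  set c := S.filter fun z => G.Adj x z ∧ G.Adj y z
  set N := S.filter fun z => G.Adj y z
  set M := S.filter fun z => G.Adj y z ∧ ¬ G.Adj x z ∧ z ≠ x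
  have h1 : (G.adjPairs S).card ≤ (G.adjPairs (S.erase y)).card + N.card + N.card := by
    have : G.adjPairs S ⊆ (G.adjPairs (S.erase y) ∪ N.image fun b => (y, b)) ∪
        N.image fun b => (b, y) := by
      rintro ⟨a, b⟩ h
      rw [mem_adjPairs] at h
      obtain ⟨ha, hb, hab⟩ := h
      simp only [Finset.mem_union, mem_adjPairs, Finset.mem_erase, Finset.mem_image, N,
        Finset.mem_filter, Prod.mk.injEq]
      by_cases hay : a = y
      · subst hay; exact Or.inl (Or.inr ⟨b, ⟨hb, hab⟩, rfl, rfl⟩)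
      by_cases hby : b = y
      · subst hby; exact Or.inr ⟨a, ⟨ha, hab.symm⟩, rfl, rfl⟩
      exact Or.inl (Or.inl ⟨⟨hay, ha⟩, ⟨hby, hb⟩, hab⟩)
    refine (Finset.card_le_card this).trans ((Finset.card_union_le _ _).trans ?_)
    exact add_le_add ((Finset.card_union_le _ _).trans (add_le_add le_rfl Finset.card_image_le))
      Finset.card_image_le
  have h2 : (G.adjPairs (S.erase y)).card + M.card + M.card ≤
      ((G.contractInto x y).adjPairs (S.erase y)).card := by
    have hsub : (G.adjPairs (S.erase y) ∪ M.image fun b => (x, b)) ∪ (M.image fun b => (b, x)) ⊆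
        (G.contractInto x y).adjPairs (S.erase y) := by
      rintro ⟨a, b⟩ h
      simp only [Finset.mem_union, mem_adjPairs, Finset.mem_erase, Finset.mem_image, M,
        Finset.mem_filter, Prod.mk.injEq, contractInto] at h ⊢
      rcases h with (⟨ha, hb, h⟩ | ⟨z, ⟨hz, h1, h2, h3⟩, rfl, rfl⟩) |
        ⟨z, ⟨hz, h1, h2, h3⟩, rfl, rfl⟩
      · exact ⟨ha, hb, h.ne, Or.inl h⟩
      · exact ⟨⟨hxy.ne, hx⟩, ⟨h1.ne', hz⟩, Ne.symm h3, Or.inr (Or.inl ⟨rfl, h1⟩)⟩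
      · exact ⟨⟨h1.ne', hz⟩, ⟨hxy.ne, hx⟩, h3, Or.inr (Or.inr ⟨rfl, h1⟩)⟩
    refine le_trans (le_of_eq ?_) (Finset.card_le_card hsub)
    rw [Finset.card_union_of_disjoint, Finset.card_union_of_disjoint,
      Finset.card_image_of_injective, Finset.card_image_of_injective]
    · intro a b h; simpa using h
    · intro a b h; simpa using h
    · rw [Finset.disjoint_left]
      rintro ⟨a, b⟩ h h'
      simp only [mem_adjPairs, Finset.mem_image, M, Finset.mem_filter, Prod.mk.injEq] at h h'
      obtain ⟨z, ⟨-, -, hz, -⟩, rfl, rfl⟩ := h'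
      exact hz h.2.2
    · rw [Finset.disjoint_left]
      rintro ⟨a, b⟩ h h'
      simp only [Finset.mem_union, mem_adjPairs, Finset.mem_image, M, Finset.mem_filter,
        Prod.mk.injEq] at h h'
      obtain ⟨z, ⟨-, -, hz, hzx⟩, rfl, rfl⟩ := h'
      rcases h with h | ⟨w, -, h, -⟩
      · exact hz h.2.2.symm
      · exact hzx h.symm
  have h3 : N.card ≤ 1 + c.card + M.card := by
    have : N ⊆ ({x} ∪ c) ∪ M := by
      intro z hz
      simp only [N, c, M, Finset.mem_union, Finset.mem_filter, Finset.mem_singleton] at hz ⊢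
      tauto
    refine (Finset.card_le_card this).trans ((Finset.card_union_le _ _).trans ?_)
    exact add_le_add ((Finset.card_union_le _ _).trans (by simp)) le_rfl
  omega

/-- Mader's theorem: a graph with many edges has a large complete minor. -/
theorem hasCliqueModel_of_card_adjPairs (G : SimpleGraph V) (S : Finset V) (k : ℕ)
    (hS : S.Nonempty) (h : 2 ^ (k + 1) * S.card ≤ (G.adjPairs S).card) :
    G.HasCliqueModel S k := by
  classical
  induction k generalizing G S with
  | zero => exact ⟨fun i => i.elim0, fun i => i.elim0, fun i => i.elim0, fun i => i.elim0,
      fun i => i.elim0, fun i => i.elim0⟩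
  | succ k ihk =>
    induction hn : S.card generalizing G S with
    | zero => simp [Finset.card_eq_zero.1 hn] at hS
    | succ n ihn =>
      have hpos : 0 < (G.adjPairs S).card :=
        lt_of_lt_of_le (Nat.mul_pos (by positivity) hS.card_pos) h
      obtain ⟨⟨x₀, y₀⟩, hxy₀⟩ := Finset.card_pos.1 hpos
      rw [mem_adjPairs] at hxy₀
      by_cases hc : ∃ x ∈ S, ∃ y ∈ S, G.Adj x y ∧
          (S.filter fun z => G.Adj x z ∧ G.Adj y z).card < 2 ^ (k + 1)
      · obtain ⟨x, hx, y, hy, hxy, hlt⟩ := hc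
        refine HasCliqueModel.of_contractInto hxy hy (ihn _ _ ⟨x, by simp [hx, hxy.ne]⟩ ?_ ?_)
        · have := card_adjPairs_le_contractInto hx hxy
          rw [Finset.card_erase_of_mem hy]
          rw [hn] at h ⊢
          have e : 2 ^ (k + 1 + 1) = 2 * 2 ^ (k + 1) := by ring
          rw [e] at h ⊢
          generalize 2 ^ (k + 1) = q at *
          simp only [Nat.add_sub_cancel]
          have : 2 * q * (n + 1) = 2 * q * n + 2 * q := by ring
          omega
        · rw [Finset.card_erase_of_mem hy, hn]; rfl
      · push Not at hc
        set T := S.filter fun y => G.Adj x₀ y with hT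
        refine HasCliqueModel.succ_of_neighbors (T := T) hxy₀.1 (Finset.filter_subset _ _)
          (fun y hy => (Finset.mem_filter.1 hy).2)
          (ihk _ _ ⟨y₀, by simpa [hT] using hxy₀.2⟩ ?_)
        have hfib : (G.adjPairs T).card = ∑ y ∈ T, (T.filter fun z => G.Adj y z).card := by
          simp only [adjPairs, Finset.card_filter, Finset.sum_product]
        rw [hfib, mul_comm, ← smul_eq_mul]
        refine Finset.card_nsmul_le_sum _ _ _ fun y hy => ?_
        rw [hT, Finset.mem_filter] at hy
        convert hc x₀ hxy₀.1 y hy.1 hy.2 using 2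
        ext z
        simp only [hT, Finset.mem_filter]
        tauto

end SimpleGraph

lemma SimpleGraph.LinkedIn.mono {V : Type*} {G : SimpleGraph V} {S T : Set V} {a b : V}
    (h : G.LinkedIn S a b) (hST : S ⊆ T) : G.LinkedIn T a b := by
  induction h with
  | refl => exact .refl
  | tail _ h ih => exact ih.tail ⟨h.1, hST h.2.1, hST h.2.2⟩

namespace Drawing

variable {V : Type} {G H : SimpleGraph V}

/-- The drawing of a subgraph induced by a drawing of a graph. -/
def ofLE (Γ : Drawing G) (h : H ≤ G) : Drawing H where
  vpos := Γ.vpos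
  vpos_inj := Γ.vpos_inj
  arc := Γ.arc
  arc_symm := Γ.arc_symm
  arc_cont u v huv := Γ.arc_cont u v (h huv)
  arc_injOn u v huv := Γ.arc_injOn u v (h huv)
  arc_start u v huv := Γ.arc_start u v (h huv)
  arc_end u v huv := Γ.arc_end u v (h huv)
  arc_avoids u v huv := Γ.arc_avoids u v (h huv)
  inter_finite u v w z h₁ h₂ := Γ.inter_finite u v w z (h h₁) (h h₂)
  no_triple_point p hp u₁ v₁ u₂ v₂ u₃ v₃ h₁ h₂ h₃ :=
    Γ.no_triple_point p hp u₁ v₁ u₂ v₂ u₃ v₃ (h h₁) (h h₂) (h h₃)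

lemma Crossing.of_ofLE {Γ : Drawing G} {h : H ≤ G} {e f : Sym2 V} {p : ℝ × ℝ}
    (hp : (Γ.ofLE h).Crossing e f p) : Γ.Crossing e f p :=
  ⟨SimpleGraph.edgeSet_mono h hp.1, SimpleGraph.edgeSet_mono h hp.2.1, hp.2.2⟩

lemma not_hasCliqueModel_five (Γ : Drawing G) (hΓ : ∀ f g, ¬ Γ.Crosses f g) {S : Finset V}
    (h : G.HasCliqueModel S 5) : False := by
  obtain ⟨B, -, hne, hconn, hdis, hadj⟩ := h
  choose P hP using hne
  have hW : ∀ i j, ∃ W : G.Walk (P i) (P j), ∀ z ∈ W.support, z ∈ B i ∪ B j := by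
    intro i j
    by_cases hij : i = j
    · subst hij
      exact ⟨SimpleGraph.Walk.nil, by simpa using hP i⟩
    · obtain ⟨a, ha, b, hb, hab⟩ := hadj i j hij
      refine SimpleGraph.LinkedIn.exists_walk ?_ (Or.inl (hP i))
      exact (((hconn i _ (hP i) a ha).mono subset_union_left).tail
        ⟨hab, Or.inl ha, Or.inr hb⟩).trans ((hconn j b hb _ (hP j)).mono subset_union_right)
  choose W hW using hW
  obtain ⟨-, -, -, -, -, -, -, -, -, -, f, -, g, -, hc⟩ := Γ.exists_crosses_of_walks P W (by
    intro a b c d _ _ hac had hbc hbd x hx hx'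
    rcases hW a b x hx with h | h <;> rcases hW c d x hx' with h' | h'
    · exact disjoint_left.1 (hdis a c hac) h h'
    · exact disjoint_left.1 (hdis a d had) h h'
    · exact disjoint_left.1 (hdis b c hbc) h h'
    · exact disjoint_left.1 (hdis b d hbd) h h')
  exact hΓ f g hc

lemma ncard_edgeSet_le [Fintype V] (Γ : Drawing G) (hΓ : ∀ f g, ¬ Γ.Crosses f g) :
    G.edgeSet.ncard ≤ 64 * Fintype.card V := by
  have hle : G.edgeSet.ncard ≤ (G.adjPairs Finset.univ).card := by
    rw [← ncard_coe_finset]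
    refine (ncard_le_ncard (t := (fun p : V × V => s(p.1, p.2)) ''
      (G.adjPairs Finset.univ : Set (V × V))) ?_).trans (ncard_image_le (Finset.finite_toSet _))
    intro f hf
    induction f using Sym2.ind with
    | _ a b => exact ⟨(a, b), by simpa [SimpleGraph.mem_adjPairs] using hf, rfl⟩
  rcases isEmpty_or_nonempty V with hV | hV
  · refine hle.trans ?_
    simp [SimpleGraph.adjPairs]
  · by_contra! hlt
    exact Γ.not_hasCliqueModel_five hΓ (G.hasCliqueModel_of_card_adjPairs Finset.univ 5
      Finset.univ_nonempty (by rw [Finset.card_univ]; omega))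

lemma exists_crossing_of_one_le_crNum (Γ : Drawing G) (h : 1 ≤ crNum G) :
    ∃ p, p ∈ Γ.crossingSet := by
  have : crNum G ≤ Γ.crossings := Nat.sInf_le ⟨Γ, rfl⟩
  have h0 : Γ.crossingSet.ncard ≠ 0 := by
    change Γ.crossings ≠ 0
    omega
  exact nonempty_of_ncard_ne_zero h0

end Drawing

/-- The skewness-1 crossing number of a skewness-1 graph is linear in the number of vertices. -/
theorem crNumRestricted_isSkewness_one_le {V : Type} [Fintype V] {G : SimpleGraph V}
    (h : ∃ Γ : Drawing G, Γ.IsSkewness 1) (hcr : 1 ≤ crNum G) :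
    crNumRestricted G (fun Γ => Γ.IsSkewness 1) ≤ 64 * Fintype.card V := by
  obtain ⟨Γ, S, hS, hΓ⟩ := h
  obtain ⟨p, hp⟩ := Γ.exists_crossing_of_one_le_crNum hcr
  obtain ⟨e, heS, f, he⟩ := hΓ p hp
  have huniq : ∀ g ∈ S, g = e := fun g hg => Finset.card_le_one.1 hS g hg e heS
  have heE : e ∈ G.edgeSet := he.1
  clear he heS hp hcr
  have hplanar : ∀ f g p, Γ.Crossing f g p → f = e ∨ g = e := by
    intro f g p h
    obtain ⟨e', he', f', h'⟩ := hΓ p ⟨f, g, h⟩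
    rw [huniq e' he'] at h'
    by_contra! hne
    exact Γ.not_mem_three_img h.1 h.2.1 heE h.2.2.1 hne.1 hne.2 h.2.2.2.2.2 h.2.2.2.1 h.2.2.2.2.1
      h'.2.2.2.1
  induction e using Sym2.ind with
  | _ u v =>
    obtain ⟨Γ', hsk, hle⟩ := Γ.exists_crossings_le heE hplanar
    have hΓ' : crNumRestricted G (fun Γ => Γ.IsSkewness 1) ≤ Γ'.crossings :=
      Nat.sInf_le ⟨Γ', hsk, rfl⟩
    refine hΓ'.trans (hle.trans ?_)
    rw [← SimpleGraph.edgeSet_deleteEdges]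
    refine (Γ.ofLE (G.deleteEdges_le _)).ncard_edgeSet_le ?_
    rintro f g ⟨p, hp⟩
    have h1 := hp.1
    have h2 := hp.2.1
    rw [SimpleGraph.edgeSet_deleteEdges] at h1 h2
    exact (hplanar f g p hp.of_ofLE).elim h1.2 h2.2

lemma one_le_crNum {V : Type} [Finite V] {G : SimpleGraph V} {ℓ k : ℕ} (hℓ : 1 ≤ ℓ)
    (h : ∃ Γ : Drawing G, Γ.IsSkewness k)
    (hcr : ℓ ≤ crNumRestricted G (fun Γ => Γ.IsSkewness k)) : 1 ≤ crNum G := by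
  obtain ⟨Γ₀, -⟩ := h
  obtain ⟨Γ, hΓ⟩ : ∃ Γ : Drawing G, Γ.crossings = crNum G :=
    Nat.sInf_mem (s := {n | ∃ Γ : Drawing G, Γ.crossings = n}) ⟨_, Γ₀, rfl⟩
  by_contra! h0
  have hempty : Γ.crossingSet = ∅ :=
    (ncard_eq_zero Γ.finite_crossingSet).1 (show Γ.crossings = 0 by omega)
  have hsk : Γ.IsSkewness k := ⟨∅, by simp, by simp [hempty]⟩
  have : crNumRestricted G (fun Γ => Γ.IsSkewness k) ≤ Γ.crossings := Nat.sInf_le ⟨Γ, hsk, rfl⟩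
  omega

/-- Two adjacent hubs `u`, `v`, both joined to all of `x 0`, …, `x 3`, and a cycle through the
`x j` in which `q j` lies between `x j` and `x (j + 1)`. -/
structure IsDoubleWheel {V : Type} (G : SimpleGraph V) (u v : V) (x q : Fin 4 → V) : Prop where
  adj_hubs : G.Adj u v
  adj_left : ∀ j, G.Adj u (x j)
  adj_right : ∀ j, G.Adj v (x j)
  adj_out : ∀ j, G.Adj (x j) (q j)
  adj_in : ∀ j, G.Adj (q j) (x (j + 1))
  x_inj : Function.Injective x
  left_ne : ∀ j, u ≠ q j
  right_ne : ∀ j, v ≠ q j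
  x_ne : ∀ i j, x i ≠ q j

/-- The edges of the closed walk `x 0, q 0, x 1, q 1, …`. -/
def rimEdges {V : Type} (x q : Fin 4 → V) : Set (Sym2 V) :=
  {f | ∃ j, f = s(x j, q j) ∨ f = s(q j, x (j + 1))}

/-- The edges joining the hubs to the vertices `x j` with `j ≠ i`. -/
def spokeEdges {V : Type} (u v : V) (x : Fin 4 → V) (i : Fin 4) : Set (Sym2 V) :=
  {f | ∃ j ≠ i, f = s(u, x j) ∨ f = s(v, x j)}

namespace IsDoubleWheel

variable {V : Type} {G : SimpleGraph V} {u v : V} {x q : Fin 4 → V}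

lemma exists_walk (h : IsDoubleWheel G u v x q) (i : Fin 4) (a b : Fin 5) (hab : a < b) :
    ∃ W : G.Walk (![u, v, x (i + 1), x (i + 2), x (i + 3)] a)
        (![u, v, x (i + 1), x (i + 2), x (i + 3)] b),
      (∀ z ∈ W.support, z = ![u, v, x (i + 1), x (i + 2), x (i + 3)] a ∨
        z = ![u, v, x (i + 1), x (i + 2), x (i + 3)] b ∨
        2 ≤ a ∧ z ∉ range ![u, v, x (i + 1), x (i + 2), x (i + 3)]) ∧
      ∀ f ∈ W.edges, (a = 0 ∧ b = 1 ∧ f = s(u, v)) ∨ (a ≤ 1 ∧ f ∈ spokeEdges u v x i) ∨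
        (2 ≤ a ∧ f ∈ rimEdges x q) := by
  have i1 : i + 1 ≠ i := by revert i; decide
  have i2 : i + 2 ≠ i := by revert i; decide
  have i3 : i + 3 ≠ i := by revert i; decide
  have e1 : i + 1 + 1 = i + 2 := by revert i; decide
  have e2 : i + 2 + 1 = i + 3 := by revert i; decide
  have e3 : i + 3 + 1 = i := by revert i; decide
  have hq : ∀ j, q j ∉ range ![u, v, x (i + 1), x (i + 2), x (i + 3)] := by
    rintro j ⟨c, hc⟩
    fin_cases c
    exacts [h.left_ne _ hc, h.right_ne _ hc, h.x_ne _ _ hc, h.x_ne _ _ hc, h.x_ne _ _ hc]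
  have hx : x i ∉ range ![u, v, x (i + 1), x (i + 2), x (i + 3)] := by
    rintro ⟨c, hc⟩
    fin_cases c
    exacts [(h.adj_left i).ne hc, (h.adj_right i).ne hc, i1 (h.x_inj hc), i2 (h.x_inj hc),
      i3 (h.x_inj hc)]
  have edge : ∀ {y z : V} (e : G.Adj y z) {Q : V → Prop} {Q' : Sym2 V → Prop}, Q y → Q z →
      Q' s(y, z) → (∀ w ∈ e.toWalk.support, Q w) ∧ ∀ f ∈ e.toWalk.edges, Q' f := by
    intro y z e Q Q' h1 h2 h3
    simp [SimpleGraph.Adj.toWalk, h1, h2, h3]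
  have spoke : ∀ {y z : V} (e : G.Adj y z) {a b : Fin 5} {Q : V → Prop}, a ≤ 1 →
      s(y, z) ∈ spokeEdges u v x i → (∀ w ∈ e.toWalk.support, w = y ∨ w = z ∨ Q w) ∧
        ∀ f ∈ e.toWalk.edges, (a = 0 ∧ b = 1 ∧ f = s(u, v)) ∨
          (a ≤ 1 ∧ f ∈ spokeEdges u v x i) ∨ (2 ≤ a ∧ f ∈ rimEdges x q) :=
    fun e _ _ _ ha hs => edge e (.inl rfl) (.inr (.inl rfl)) (.inr (.inl ⟨ha, hs⟩))
  have hop : ∀ j k, j + 1 = k → ∃ W : G.Walk (x j) (x k),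
      (∀ z ∈ W.support, z = x j ∨ z = x k ∨
        z ∉ range ![u, v, x (i + 1), x (i + 2), x (i + 3)]) ∧
      ∀ f ∈ W.edges, f ∈ rimEdges x q := by
    rintro j _ rfl
    refine ⟨.cons (h.adj_out j) (.cons (h.adj_in j) .nil), fun z hz => ?_, fun f hf => ?_⟩
    · simp only [SimpleGraph.Walk.support_cons, SimpleGraph.Walk.support_nil, List.mem_cons,
        List.not_mem_nil, or_false] at hz
      rcases hz with rfl | rfl | rfl
      exacts [.inl rfl, .inr (.inr (hq _)), .inr (.inl rfl)]
    · simp only [SimpleGraph.Walk.edges_cons, SimpleGraph.Walk.edges_nil, List.mem_cons,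
        List.not_mem_nil, or_false] at hf
      exact ⟨j, hf⟩
  have hop₂ : ∃ W : G.Walk (x (i + 1)) (x (i + 3)),
      (∀ z ∈ W.support, z = x (i + 1) ∨ z = x (i + 3) ∨
        z ∉ range ![u, v, x (i + 1), x (i + 2), x (i + 3)]) ∧
      ∀ f ∈ W.edges, f ∈ rimEdges x q := by
    obtain ⟨W₁, hW₁, hE₁⟩ := hop _ _ e3
    obtain ⟨W₂, hW₂, hE₂⟩ := hop i _ rfl
    refine ⟨(W₁.append W₂).reverse, fun z hz => ?_, fun f hf => ?_⟩
    · rw [SimpleGraph.Walk.support_reverse, List.mem_reverse,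
        SimpleGraph.Walk.mem_support_append_iff] at hz
      rcases hz with hz | hz
      · rcases hW₁ z hz with rfl | rfl | hz
        exacts [.inr (.inl rfl), .inr (.inr hx), .inr (.inr hz)]
      · rcases hW₂ z hz with rfl | rfl | hz
        exacts [.inr (.inr hx), .inl rfl, .inr (.inr hz)]
    · rw [SimpleGraph.Walk.edges_reverse, List.mem_reverse, SimpleGraph.Walk.edges_append,
        List.mem_append] at hf
      exact hf.elim (hE₁ f) (hE₂ f)
  fin_cases a <;> fin_cases b <;> first | (exact absurd hab (by decide)) | skip
  · exact ⟨h.adj_hubs.toWalk, edge _ (.inl rfl) (.inr (.inl rfl)) (.inl ⟨rfl, rfl, rfl⟩)⟩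
  · exact ⟨(h.adj_left _).toWalk, spoke _ (by decide) ⟨_, i1, .inl rfl⟩⟩
  · exact ⟨(h.adj_left _).toWalk, spoke _ (by decide) ⟨_, i2, .inl rfl⟩⟩
  · exact ⟨(h.adj_left _).toWalk, spoke _ (by decide) ⟨_, i3, .inl rfl⟩⟩
  · exact ⟨(h.adj_right _).toWalk, spoke _ (by decide) ⟨_, i1, .inr rfl⟩⟩
  · exact ⟨(h.adj_right _).toWalk, spoke _ (by decide) ⟨_, i2, .inr rfl⟩⟩
  · exact ⟨(h.adj_right _).toWalk, spoke _ (by decide) ⟨_, i3, .inr rfl⟩⟩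
  · obtain ⟨W, hW, hE⟩ := hop _ _ e1
    exact ⟨W, fun z hz => (hW z hz).imp_right (.imp_right fun h => ⟨by decide, h⟩),
      fun f hf => .inr (.inr ⟨by decide, hE f hf⟩)⟩
  · obtain ⟨W, hW, hE⟩ := hop₂
    exact ⟨W, fun z hz => (hW z hz).imp_right (.imp_right fun h => ⟨by decide, h⟩),
      fun f hf => .inr (.inr ⟨by decide, hE f hf⟩)⟩
  · obtain ⟨W, hW, hE⟩ := hop _ _ e2
    exact ⟨W, fun z hz => (hW z hz).imp_right (.imp_right fun h => ⟨by decide, h⟩),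
      fun f hf => .inr (.inr ⟨by decide, hE f hf⟩)⟩

lemma exists_crosses (h : IsDoubleWheel G u v x q) (Γ : Drawing G) (i : Fin 4) :
    ∃ f g, Γ.Crosses f g ∧ f ∈ insert s(u, v) (spokeEdges u v x i) ∧
      g ∈ spokeEdges u v x i ∪ rimEdges x q ∧ (f = s(u, v) → g ∈ rimEdges x q) := by
  have h12 : i + 1 ≠ i + 2 := by revert i; decide
  have h13 : i + 1 ≠ i + 3 := by revert i; decide
  have h23 : i + 2 ≠ i + 3 := by revert i; decide
  set P : Fin 5 → V := ![u, v, x (i + 1), x (i + 2), x (i + 3)] with hPdef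
  have hP : Function.Injective P := by
    have hx : ∀ j k : Fin 4, j ≠ k → x j ≠ x k := fun j k => h.x_inj.ne
    have hlt : ∀ a b : Fin 5, a < b → P a ≠ P b := by
      intro a b hab
      fin_cases a <;> fin_cases b <;> first | (exact absurd hab (by decide)) | skip
      exacts [h.adj_hubs.ne, (h.adj_left _).ne, (h.adj_left _).ne, (h.adj_left _).ne,
        (h.adj_right _).ne, (h.adj_right _).ne, (h.adj_right _).ne, hx _ _ h12, hx _ _ h13,
        hx _ _ h23]
    intro a b hab
    by_contra hne
    rcases lt_or_gt_of_ne hne with hlt' | hlt'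
    exacts [hlt a b hlt' hab, hlt b a hlt' hab.symm]
  have hwalk := h.exists_walk i
  rw [← hPdef] at hwalk
  have hW : ∀ a b, ∃ W : G.Walk (P a) (P b), a < b →
      (∀ z ∈ W.support, z = P a ∨ z = P b ∨ 2 ≤ a ∧ z ∉ range P) ∧
      ∀ f ∈ W.edges, (a = 0 ∧ b = 1 ∧ f = s(u, v)) ∨ (a ≤ 1 ∧ f ∈ spokeEdges u v x i) ∨
        (2 ≤ a ∧ f ∈ rimEdges x q) := by
    intro a b
    rcases lt_trichotomy a b with hab | rfl | hab
    · obtain ⟨W, hW⟩ := hwalk a b hab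
      exact ⟨W, fun _ => hW⟩
    · exact ⟨.nil, fun h => absurd h (lt_irrefl _)⟩
    · obtain ⟨W, -⟩ := hwalk b a hab
      exact ⟨W.reverse, fun h => absurd h (lt_asymm hab)⟩
  choose W hW using hW
  obtain ⟨a, b, c, d, hab, hcd, hac, had, hbc, hbd, f, hf, g, hg, hfg⟩ :=
    Γ.exists_crosses_of_walks P W (by
      intro a b c d hab hcd hac had hbc hbd z hz hz'
      rcases (hW a b hab).1 z hz with rfl | rfl | ⟨ha, hz₁⟩ <;>
        rcases (hW c d hcd).1 _ hz' with h' | h' | ⟨hc, hz₂⟩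
      · exact hac (hP h')
      · exact had (hP h')
      · exact hz₂ (mem_range_self _)
      · exact hbc (hP h')
      · exact hbd (hP h')
      · exact hz₂ (mem_range_self _)
      · exact hz₁ (h' ▸ mem_range_self _)
      · exact hz₁ (h' ▸ mem_range_self _)
      · omega)
  have hf' := (hW a b hab).2 f hf
  have hg' := (hW c d hcd).2 g hg
  have hgf : Γ.Crosses g f := hfg.imp fun _ hp => hp.symm
  rcases hf' with ⟨ha, hb, rfl⟩ | ⟨ha, hf'⟩ | ⟨ha, hf'⟩ <;>
    rcases hg' with ⟨hc, hd, rfl⟩ | ⟨hc, hg'⟩ | ⟨hc, hg'⟩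
  · omega
  · omega
  · exact ⟨_, _, hfg, .inl rfl, .inr hg', fun _ => hg'⟩
  · omega
  · refine ⟨_, _, hfg, .inr hf', .inl hg', ?_⟩
    rintro rfl
    obtain ⟨j, -, h' | h'⟩ := hf'
    · rw [Sym2.eq_iff] at h'
      rcases h' with ⟨-, h'⟩ | ⟨h', -⟩
      exacts [((h.adj_right j).ne h').elim, ((h.adj_left j).ne h').elim]
    · rw [Sym2.eq_iff] at h'
      rcases h' with ⟨h', -⟩ | ⟨h', -⟩
      exacts [(h.adj_hubs.ne h').elim, ((h.adj_left j).ne h').elim]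
  · exact ⟨_, _, hfg, .inr hf', .inr hg', fun _ => hg'⟩
  · exact ⟨_, _, hgf, .inl rfl, .inr hf', fun _ => hf'⟩
  · exact ⟨_, _, hgf, .inr hg', .inr hf', fun _ => hf'⟩
  · omega

end IsDoubleWheel

/-- A graph containing `ℓ ≥ 2` double wheels with common hubs and common `x j`, whose rims are
otherwise disjoint, has at least `ℓ` crossings in every skewness-1 drawing. -/
theorem Drawing.le_crossings_of_isDoubleWheel {V : Type} [Finite V] {G : SimpleGraph V}
    (Γ : Drawing G) (hΓ : Γ.IsSkewness 1) {ℓ : ℕ} (hℓ : 2 ≤ ℓ) {u v : V} {x : Fin 4 → V}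
    {q : Fin ℓ → Fin 4 → V} (h : ∀ k, IsDoubleWheel G u v x (q k))
    (hq : ∀ k k' j j', q k j = q k' j' → k = k') : ℓ ≤ Γ.crossings := by
  have hdisj : ∀ k k' f, f ∈ rimEdges x (q k) → f ∈ rimEdges x (q k') → k = k' := by
    intro k k' f ⟨j, hj⟩ ⟨j', hj'⟩
    have hmem : q k j ∈ f := by rcases hj with rfl | rfl <;> simp
    have : ∃ i, q k j = x i ∨ q k j = q k' j' := by
      rcases hj' with rfl | rfl <;> rw [Sym2.mem_iff] at hmem
      exacts [⟨_, hmem⟩, ⟨_, hmem.symm⟩]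
    obtain ⟨i, hi | hi⟩ := this
    exacts [((h k).x_ne _ _ hi.symm).elim, hq _ _ _ _ hi]
  obtain ⟨S, hS, hΓ⟩ := hΓ
  obtain ⟨e, hplanar⟩ : ∃ e, ∀ f g, Γ.Crosses f g → f = e ∨ g = e := by
    obtain ⟨f₀, g₀, ⟨p₀, hp₀⟩, -⟩ := (h ⟨0, by omega⟩).exists_crosses Γ 0
    obtain ⟨e, heS, f₁, he⟩ := hΓ p₀ ⟨_, _, hp₀⟩
    refine ⟨e, fun f g ⟨p, hp⟩ => ?_⟩
    obtain ⟨e', he', f', h'⟩ := hΓ p ⟨f, g, hp⟩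
    rw [Finset.card_le_one.1 hS e' he' e heS] at h'
    by_contra! hne
    exact Γ.not_mem_three_img hp.1 hp.2.1 he.1 hp.2.2.1 hne.1 hne.2 hp.2.2.2.2.2 hp.2.2.2.1
      hp.2.2.2.2.1 h'.2.2.2.1
  have heuv : e = s(u, v) := by
    by_contra hne
    obtain ⟨k, hk⟩ : ∃ k, e ∉ rimEdges x (q k) := by
      by_contra! hall
      have := hdisj ⟨0, by omega⟩ ⟨1, by omega⟩ e (hall _) (hall _)
      simp at this
    obtain ⟨i, hi⟩ : ∃ i, e ∉ spokeEdges u v x i := by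
      by_contra! hall
      obtain ⟨j, -, hj⟩ := hall 0
      obtain ⟨j', hne', hj'⟩ := hall j
      have h1 : x j ∈ e := by rcases hj with rfl | rfl <;> simp
      have h2 : x j = u ∨ x j = v ∨ x j = x j' := by
        rcases hj' with rfl | rfl <;> rw [Sym2.mem_iff] at h1 <;> tauto
      rcases h2 with h2 | h2 | h2
      exacts [((h k).adj_left j).ne h2.symm, ((h k).adj_right j).ne h2.symm,
        hne' ((h k).x_inj h2).symm]
    obtain ⟨f, g, hfg, hf, hg, -⟩ := (h k).exists_crosses Γ i
    rcases hplanar f g hfg with rfl | rfl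
    · exact hf.elim hne hi
    · exact hg.elim hi hk
  subst heuv
  have hk : ∀ k, ∃ p, ∃ g ∈ rimEdges x (q k), Γ.Crossing s(u, v) g p := by
    intro k
    have hsp : s(u, v) ∉ spokeEdges u v x 0 ∪ rimEdges x (q k) := by
      rintro (⟨j, -, hj⟩ | ⟨j, hj⟩)
      · have : x j ∈ s(u, v) := by rcases hj with hj | hj <;> rw [hj] <;> simp
        rcases Sym2.mem_iff.1 this with h' | h'
        exacts [((h k).adj_left j).ne h'.symm, ((h k).adj_right j).ne h'.symm]
      · have : q k j ∈ s(u, v) := by rcases hj with hj | hj <;> rw [hj] <;> simp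
        rcases Sym2.mem_iff.1 this with h' | h'
        exacts [(h k).left_ne j h'.symm, (h k).right_ne j h'.symm]
    obtain ⟨f, g, ⟨p, hp⟩, -, hg, hg'⟩ := (h k).exists_crosses Γ 0
    rcases hplanar f g ⟨p, hp⟩ with rfl | rfl
    · exact ⟨p, g, hg' rfl, hp⟩
    · exact absurd hg hsp
  choose p g hg hp using hk
  have hinj : Function.Injective p := by
    intro k k' hkk
    by_contra hne
    refine Γ.not_mem_three_img (hp k).1 (hp k).2.1 (hp k').2.1 (hp k).2.2.1 (hp k').2.2.1
      (fun h => hne (hdisj k k' _ (hg k) (h ▸ hg k'))) (hp k).2.2.2.2.2 (hp k).2.2.2.1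
      (hp k).2.2.2.2.1 ?_
    rw [hkk]
    exact (hp k').2.2.2.2.1
  calc ℓ = (range p).ncard := by
        rw [← image_univ, ncard_image_of_injective _ hinj, ncard_univ, Nat.card_fin]
    _ ≤ Γ.crossings := ncard_le_ncard (by rintro _ ⟨k, rfl⟩; exact ⟨_, _, hp k⟩)
        Γ.finite_crossingSet

/-- Two segments, parametrised over the unit interval, meet only at common endpoints or at
interior points satisfying `X`, and in the latter case they are not parallel. -/
def MeetsProperly (X : ℝ × ℝ → Prop) (a b c d : ℝ × ℝ) : Prop :=
  ∀ s ∈ Icc (0 : ℝ) 1, ∀ t ∈ Icc (0 : ℝ) 1,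
    AffineMap.lineMap a b s = AffineMap.lineMap c d t →
      ((s = 0 ∨ s = 1) ∧ (t = 0 ∨ t = 1)) ∨
      (s ∈ Ioo (0 : ℝ) 1 ∧ t ∈ Ioo (0 : ℝ) 1 ∧ X (AffineMap.lineMap a b s) ∧
        (b.1 - a.1) * (d.2 - c.2) - (b.2 - a.2) * (d.1 - c.1) ≠ 0)

namespace MeetsProperly

variable {X : ℝ × ℝ → Prop} {a b c d : ℝ × ℝ}

lemma swap_left (h : MeetsProperly X a b c d) : MeetsProperly X b a c d := by
  intro s hs t ht hst
  have hs' : 1 - s ∈ Icc (0 : ℝ) 1 := ⟨by linarith [hs.2], by linarith [hs.1]⟩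
  rw [← AffineMap.lineMap_apply_one_sub] at hst ⊢
  rcases h _ hs' t ht hst with ⟨h1, h2⟩ | ⟨h1, h2, h3, h4⟩
  · exact .inl ⟨h1.symm.imp (fun h => by linarith) (fun h => by linarith), h2⟩
  · refine .inr ⟨⟨by linarith [h1.2], by linarith [h1.1]⟩, h2, h3, fun h => h4 ?_⟩
    linear_combination -h

lemma swap_right (h : MeetsProperly X a b c d) : MeetsProperly X a b d c := by
  intro s hs t ht hst
  have ht' : 1 - t ∈ Icc (0 : ℝ) 1 := ⟨by linarith [ht.2], by linarith [ht.1]⟩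
  rw [← AffineMap.lineMap_apply_one_sub (p₀ := c)] at hst
  rcases h s hs _ ht' hst with ⟨h1, h2⟩ | ⟨h1, h2, h3, h4⟩
  · exact .inl ⟨h1, h2.symm.imp (fun h => by linarith) (fun h => by linarith)⟩
  · refine .inr ⟨h1, ⟨by linarith [h2.2], by linarith [h2.1]⟩, h3, fun h => h4 ?_⟩
    linear_combination -h

lemma finite_inter (h : MeetsProperly X a b c d) :
    ((AffineMap.lineMap a b : ℝ → ℝ × ℝ) '' Icc 0 1 ∩
      (AffineMap.lineMap c d : ℝ → ℝ × ℝ) '' Icc 0 1).Finite := by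
  by_cases hdet : (b.1 - a.1) * (d.2 - c.2) - (b.2 - a.2) * (d.1 - c.1) = 0
  · refine (Set.toFinite {a, b}).subset ?_
    rintro _ ⟨⟨s, hs, rfl⟩, t, ht, hst⟩
    rcases h s hs t ht hst.symm with ⟨rfl | rfl, -⟩ | h'
    · simp
    · simp
    · exact absurd hdet h'.2.2.2
  · refine Set.Subsingleton.finite ?_
    rintro _ ⟨⟨s, -, rfl⟩, t, -, hst⟩ _ ⟨⟨s', -, rfl⟩, t', -, hst'⟩
    have h1 := congrArg Prod.fst hst
    have h2 := congrArg Prod.snd hst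
    have h1' := congrArg Prod.fst hst'
    have h2' := congrArg Prod.snd hst'
    simp only [AffineMap.lineMap_apply, vsub_eq_sub, vadd_eq_add, Prod.fst_add, Prod.snd_add,
      Prod.smul_fst, Prod.smul_snd, Prod.fst_sub, Prod.snd_sub, smul_eq_mul] at h1 h2 h1' h2'
    have : (s - s') * ((b.1 - a.1) * (d.2 - c.2) - (b.2 - a.2) * (d.1 - c.1)) = 0 := by
      linear_combination (h1' - h1) * (d.2 - c.2) - (h2' - h2) * (d.1 - c.1)
    rw [sub_eq_zero.1 ((mul_eq_zero.1 this).resolve_right hdet)]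

end MeetsProperly

namespace Drawing

variable {V : Type} {G : SimpleGraph V}

/-- The straight-line drawing with vertex positions `pos`, all of whose crossings are
specified by `X`. -/
def straight (G : SimpleGraph V) (pos : V → ℝ × ℝ) (hpos : Function.Injective pos)
    (hdeg : ∀ z, ∃ w, G.Adj z w) (X : Sym2 V → Sym2 V → ℝ × ℝ → Prop)
    (hX : ∀ e f g p, e ≠ f → e ≠ g → f ≠ g → X e f p → X e g p → X f g p → False)
    (hmeet : ∀ a b c d, G.Adj a b → G.Adj c d → s(a, b) ≠ s(c, d) →
      MeetsProperly (X s(a, b) s(c, d)) (pos a) (pos b) (pos c) (pos d)) : Drawing G where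
  vpos := pos
  vpos_inj := hpos
  arc a b := AffineMap.lineMap (pos a) (pos b)
  arc_symm a b t := (AffineMap.lineMap_apply_one_sub ..).symm
  arc_cont a b _ := AffineMap.lineMap_continuous.continuousOn
  arc_injOn a b h := (AffineMap.lineMap_injective ℝ (hpos.ne h.ne)).injOn
  arc_start a b _ := AffineMap.lineMap_apply_zero ..
  arc_end a b _ := AffineMap.lineMap_apply_one ..
  arc_avoids a b h t ht := by
    rintro ⟨z, hz⟩
    obtain ⟨w, hw⟩ := hdeg z
    by_cases he : s(a, b) = s(z, w)
    · have hinj := AffineMap.lineMap_injective ℝ (hpos.ne h.ne)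
      rcases Sym2.eq_iff.1 he with ⟨rfl, -⟩ | ⟨-, rfl⟩
      · exact ht.1.ne (hinj ((AffineMap.lineMap_apply_zero ..).trans hz))
      · exact ht.2.ne (hinj ((AffineMap.lineMap_apply_one ..).trans hz)).symm
    · rw [← AffineMap.lineMap_apply_zero (k := ℝ) (pos z) (pos w)] at hz
      rcases hmeet a b z w h hw he t (Ioo_subset_Icc_self ht) 0 (by simp) hz.symm with h' | h'
      · exact h'.1.elim ht.1.ne' ht.2.ne
      · exact lt_irrefl _ h'.2.1.1
  inter_finite a b c d h h' hne := (hmeet a b c d h h' hne).finite_inter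
  no_triple_point p hp a b c d x y h₁ h₂ h₃ h₁₂ h₁₃ h₂₃ := by
    have key : ∀ a b c d, G.Adj a b → G.Adj c d → s(a, b) ≠ s(c, d) →
        p ∈ (AffineMap.lineMap (pos a) (pos b) : ℝ → ℝ × ℝ) '' Icc 0 1 →
        p ∈ (AffineMap.lineMap (pos c) (pos d) : ℝ → ℝ × ℝ) '' Icc 0 1 →
        X s(a, b) s(c, d) p := by
      rintro a b c d h h' hne ⟨s, hs, rfl⟩ ⟨t, ht, hst⟩
      rcases hmeet a b c d h h' hne s hs t ht hst.symm with ⟨rfl | rfl, -⟩ | h''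
      · exact absurd ⟨a, (AffineMap.lineMap_apply_zero ..).symm⟩ hp
      · exact absurd ⟨b, (AffineMap.lineMap_apply_one ..).symm⟩ hp
      · exact h''.2.2.1
    rintro ⟨p₁, p₂, p₃⟩
    exact hX _ _ _ p h₁₂ h₁₃ h₂₃ (key _ _ _ _ h₁ h₂ h₁₂ p₁ p₂) (key _ _ _ _ h₁ h₃ h₁₃ p₁ p₃)
      (key _ _ _ _ h₂ h₃ h₂₃ p₂ p₃)

/-- If a set of positions satisfies the conditions of `Drawing.straight` with respect to an
orientation `R` of the edges, then there is a drawing all of whose crossings satisfy `X`. -/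
lemma exists_of_meetsProperly (R : V → V → Prop) (hR : ∀ a b, G.Adj a b ↔ R a b ∨ R b a)
    (pos : V → ℝ × ℝ) (hpos : Function.Injective pos)
    (hdeg : ∀ z, ∃ w, G.Adj z w) (X : Sym2 V → Sym2 V → ℝ × ℝ → Prop)
    (hX : ∀ e f g p, e ≠ f → e ≠ g → f ≠ g → X e f p → X e g p → X f g p → False)
    (hmeet : ∀ a b c d, R a b → R c d → s(a, b) ≠ s(c, d) →
      MeetsProperly (X s(a, b) s(c, d)) (pos a) (pos b) (pos c) (pos d)) :
    ∃ Γ : Drawing G, ∀ e f p, Γ.Crossing e f p → X e f p := by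
  have hmeet₁ : ∀ a b c d, G.Adj a b → R c d → s(a, b) ≠ s(c, d) →
      MeetsProperly (X s(a, b) s(c, d)) (pos a) (pos b) (pos c) (pos d) := by
    intro a b c d h h' hne
    rcases (hR a b).1 h with h | h
    · exact hmeet a b c d h h' hne
    · rw [Sym2.eq_swap] at hne ⊢
      exact (hmeet b a c d h h' hne).swap_left
  have hmeet₂ : ∀ a b c d, G.Adj a b → G.Adj c d → s(a, b) ≠ s(c, d) →
      MeetsProperly (X s(a, b) s(c, d)) (pos a) (pos b) (pos c) (pos d) := by
    intro a b c d h h' hne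
    rcases (hR c d).1 h' with h' | h'
    · exact hmeet₁ a b c d h h' hne
    · rw [Sym2.eq_swap (a := c)] at hne ⊢
      exact (hmeet₁ a b d c h h' hne).swap_right
  refine ⟨straight G pos hpos hdeg X hX hmeet₂, ?_⟩
  rintro e f p ⟨he, hf, hne, ⟨h₁, h₂, hp⟩⟩
  induction e using Sym2.ind with
  | _ a b =>
    induction f using Sym2.ind with
    | _ c d =>
      obtain ⟨s, hs, rfl⟩ := h₁
      obtain ⟨t, ht, hst⟩ := h₂
      rcases hmeet₂ a b c d he hf hne s hs t ht hst.symm with ⟨rfl | rfl, -⟩ | h''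
      · exact absurd ⟨a, (AffineMap.lineMap_apply_zero ..).symm⟩ hp
      · exact absurd ⟨b, (AffineMap.lineMap_apply_one ..).symm⟩ hp
      · exact h''.2.2.1

end Drawing

/-- The arcs of the graph `bundleWheel`, oriented from the smaller to the larger vertex. -/
def WheelArc (a b : ℕ) : Prop :=
  (a = 0 ∧ b = 1) ∨ (a ≤ 1 ∧ 2 ≤ b ∧ b ≤ 5) ∨
    (2 ≤ a ∧ a ≤ 5 ∧ 6 ≤ b ∧ (b % 4 = a % 4 ∨ (b + 1) % 4 = a % 4))

lemma WheelArc.cases {a b : ℕ} (h : WheelArc a b) :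
    (a = 0 ∧ b = 1) ∨
    (a = 0 ∧ b = 2) ∨
    (a = 0 ∧ b = 3) ∨
    (a = 0 ∧ b = 4) ∨
    (a = 0 ∧ b = 5) ∨
    (a = 1 ∧ b = 2) ∨
    (a = 1 ∧ b = 3) ∨
    (a = 1 ∧ b = 4) ∨
    (a = 1 ∧ b = 5) ∨
    (a = 4 ∧ 6 ≤ b ∧ b % 4 = 0) ∨
    (a = 5 ∧ 6 ≤ b ∧ b % 4 = 0) ∨
    (a = 5 ∧ 6 ≤ b ∧ b % 4 = 1) ∨
    (a = 2 ∧ 6 ≤ b ∧ b % 4 = 1) ∨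
    (a = 2 ∧ 6 ≤ b ∧ b % 4 = 2) ∨
    (a = 3 ∧ 6 ≤ b ∧ b % 4 = 2) ∨
    (a = 3 ∧ 6 ≤ b ∧ b % 4 = 3) ∨
    (a = 4 ∧ 6 ≤ b ∧ b % 4 = 3) := by
  rcases h with h | ⟨ha, hb, hb'⟩ | ⟨ha, ha', hb, h⟩
  · exact .inl h
  · interval_cases a <;> interval_cases b <;> simp
  · interval_cases a <;> rcases h with h | h <;> simp [hb] <;> omega

/-- Vertex positions of `bundleWheel` with the vertex `1` outside the rim, so that every crossing
involves the edge `{0, 1}`. -/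
def outerPos (a : ℕ) : ℝ × ℝ :=
  if a = 0 then (1 / 2, 0) else if a = 1 then (1 / 2, -3) else if a = 2 then (-3, 1)
  else if a = 3 then (3, 1) else if a = 4 then (1, -1) else if a = 5 then (-1, -1)
  else if a % 4 = 0 then (0, -1 + (a : ℝ)⁻¹)
  else if a % 4 = 1 then (-2 + (a : ℝ)⁻¹, 0)
  else if a % 4 = 2 then (0, 1 + (a : ℝ)⁻¹)
  else (2 - (a : ℝ)⁻¹, 0)

lemma outerPos_cases (a : ℕ) {p : ℝ × ℝ} (hp : outerPos a = p) {r : ℝ}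
    (hr : 6 ≤ a → r = (a : ℝ)⁻¹) :
    (a = 0 ∧ p.1 = 1 / 2 ∧ p.2 = 0) ∨
    (a = 1 ∧ p.1 = 1 / 2 ∧ p.2 = -3) ∨
    (a = 2 ∧ p.1 = -3 ∧ p.2 = 1) ∨
    (a = 3 ∧ p.1 = 3 ∧ p.2 = 1) ∨
    (a = 4 ∧ p.1 = 1 ∧ p.2 = -1) ∨
    (a = 5 ∧ p.1 = -1 ∧ p.2 = -1) ∨
    (6 ≤ a ∧ a % 4 = 0 ∧ p.1 = 0 ∧ p.2 = -1 + r) ∨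
    (6 ≤ a ∧ a % 4 = 1 ∧ p.1 = -2 + r ∧ p.2 = 0) ∨
    (6 ≤ a ∧ a % 4 = 2 ∧ p.1 = 0 ∧ p.2 = 1 + r) ∨
    (6 ≤ a ∧ a % 4 = 3 ∧ p.1 = 2 - r ∧ p.2 = 0) := by
  subst hp
  by_cases h6 : 6 ≤ a
  · obtain ⟨h0, h1, h2, h3, h4, h5⟩ :
        a ≠ 0 ∧ a ≠ 1 ∧ a ≠ 2 ∧ a ≠ 3 ∧ a ≠ 4 ∧ a ≠ 5 := by omega
    have hm : a % 4 = 0 ∨ a % 4 = 1 ∨ a % 4 = 2 ∨ a % 4 = 3 := by omega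
    rcases hm with hm | hm | hm | hm <;> simp [outerPos, h0, h1, h2, h3, h4, h5, h6, hm, hr h6]
  · interval_cases a <;> simp [outerPos]

lemma outerPos_lineMap_cases {a b : ℕ} (hab : WheelArc a b) {s w : ℝ}
    (hw : 6 ≤ b → w = s * (b : ℝ)⁻¹) {p : ℝ × ℝ}
    (hp : AffineMap.lineMap (outerPos a) (outerPos b) s = p) :
    (a = 0 ∧ b = 1 ∧ p.1 = 1 / 2 ∧ p.2 = -3 * s) ∨
    (a = 0 ∧ b = 2 ∧ p.1 = 1 / 2 - 7 / 2 * s ∧ p.2 = s) ∨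
    (a = 0 ∧ b = 3 ∧ p.1 = 1 / 2 + 5 / 2 * s ∧ p.2 = s) ∨
    (a = 0 ∧ b = 4 ∧ p.1 = 1 / 2 + 1 / 2 * s ∧ p.2 = -s) ∨
    (a = 0 ∧ b = 5 ∧ p.1 = 1 / 2 - 3 / 2 * s ∧ p.2 = -s) ∨
    (a = 1 ∧ b = 2 ∧ p.1 = 1 / 2 - 7 / 2 * s ∧ p.2 = -3 + 4 * s) ∨
    (a = 1 ∧ b = 3 ∧ p.1 = 1 / 2 + 5 / 2 * s ∧ p.2 = -3 + 4 * s) ∨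
    (a = 1 ∧ b = 4 ∧ p.1 = 1 / 2 + 1 / 2 * s ∧ p.2 = -3 + 2 * s) ∨
    (a = 1 ∧ b = 5 ∧ p.1 = 1 / 2 - 3 / 2 * s ∧ p.2 = -3 + 2 * s) ∨
    (a = 4 ∧ 6 ≤ b ∧ b % 4 = 0 ∧ p.1 = 1 - s ∧ p.2 = -1 + w) ∨
    (a = 5 ∧ 6 ≤ b ∧ b % 4 = 0 ∧ p.1 = -1 + s ∧ p.2 = -1 + w) ∨
    (a = 5 ∧ 6 ≤ b ∧ b % 4 = 1 ∧ p.1 = -1 - s + w ∧ p.2 = -1 + s) ∨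
    (a = 2 ∧ 6 ≤ b ∧ b % 4 = 1 ∧ p.1 = -3 + s + w ∧ p.2 = 1 - s) ∨
    (a = 2 ∧ 6 ≤ b ∧ b % 4 = 2 ∧ p.1 = -3 + 3 * s ∧ p.2 = 1 + w) ∨
    (a = 3 ∧ 6 ≤ b ∧ b % 4 = 2 ∧ p.1 = 3 - 3 * s ∧ p.2 = 1 + w) ∨
    (a = 3 ∧ 6 ≤ b ∧ b % 4 = 3 ∧ p.1 = 3 - s - w ∧ p.2 = 1 - s) ∨
    (a = 4 ∧ 6 ≤ b ∧ b % 4 = 3 ∧ p.1 = 1 + s - w ∧ p.2 = -1 + s) := by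
  subst hp
  have key : ∀ c d : ℝ × ℝ, (AffineMap.lineMap c d s).1 = (1 - s) * c.1 + s * d.1 ∧
      (AffineMap.lineMap c d s).2 = (1 - s) * c.2 + s * d.2 := by
    intro c d
    simp only [AffineMap.lineMap_apply, vsub_eq_sub, vadd_eq_add, Prod.fst_add, Prod.snd_add,
      Prod.smul_fst, Prod.smul_snd, Prod.fst_sub, Prod.snd_sub, smul_eq_mul]
    constructor <;> ring
  rw [(key _ _).1, (key _ _).2]
  refine Or.imp ?_ (Or.imp ?_ (Or.imp ?_ (Or.imp ?_ (Or.imp ?_ (Or.imp ?_ (Or.imp ?_ (Or.imp ?_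
    (Or.imp ?_ (Or.imp ?_ (Or.imp ?_ (Or.imp ?_ (Or.imp ?_ (Or.imp ?_ (Or.imp ?_
      (Or.imp ?_ ?_))))))))))))))) hab.cases
  all_goals first
    | rintro ⟨rfl, rfl⟩
      refine ⟨rfl, rfl, ?_, ?_⟩ <;> norm_num [outerPos] <;> ring
    | rintro ⟨rfl, hb, hm⟩
      obtain ⟨h0, h1, h2, h3, h4, h5⟩ :
          b ≠ 0 ∧ b ≠ 1 ∧ b ≠ 2 ∧ b ≠ 3 ∧ b ≠ 4 ∧ b ≠ 5 := by omega
      refine ⟨rfl, hb, hm, ?_, ?_⟩ <;>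
        norm_num [outerPos, hm, h0, h1, h2, h3, h4, h5, hw hb] <;> ring

/-- Vertex positions of `bundleWheel` with both hubs inside the rim, producing two crossings. -/
def innerPos (a : ℕ) : ℝ × ℝ :=
  if a = 0 then (1, 1) else if a = 1 then (0, 0) else if a = 2 then (4, 0)
  else if a = 3 then (0, 4) else if a = 4 then (-4, 0) else if a = 5 then (0, -4)
  else if a % 4 = 0 then (-2 - (a : ℝ)⁻¹, -2 - (a : ℝ)⁻¹)
  else if a % 4 = 1 then (2 + (a : ℝ)⁻¹, -2 - (a : ℝ)⁻¹)
  else if a % 4 = 2 then (2 + (a : ℝ)⁻¹, 2 + (a : ℝ)⁻¹)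
  else (-2 - (a : ℝ)⁻¹, 2 + (a : ℝ)⁻¹)

lemma innerPos_cases (a : ℕ) {p : ℝ × ℝ} (hp : innerPos a = p) {r : ℝ}
    (hr : 6 ≤ a → r = (a : ℝ)⁻¹) :
    (a = 0 ∧ p.1 = 1 ∧ p.2 = 1) ∨
    (a = 1 ∧ p.1 = 0 ∧ p.2 = 0) ∨
    (a = 2 ∧ p.1 = 4 ∧ p.2 = 0) ∨
    (a = 3 ∧ p.1 = 0 ∧ p.2 = 4) ∨
    (a = 4 ∧ p.1 = -4 ∧ p.2 = 0) ∨
    (a = 5 ∧ p.1 = 0 ∧ p.2 = -4) ∨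
    (6 ≤ a ∧ a % 4 = 0 ∧ p.1 = -2 - r ∧ p.2 = -2 - r) ∨
    (6 ≤ a ∧ a % 4 = 1 ∧ p.1 = 2 + r ∧ p.2 = -2 - r) ∨
    (6 ≤ a ∧ a % 4 = 2 ∧ p.1 = 2 + r ∧ p.2 = 2 + r) ∨
    (6 ≤ a ∧ a % 4 = 3 ∧ p.1 = -2 - r ∧ p.2 = 2 + r) := by
  subst hp
  by_cases h6 : 6 ≤ a
  · obtain ⟨h0, h1, h2, h3, h4, h5⟩ :
        a ≠ 0 ∧ a ≠ 1 ∧ a ≠ 2 ∧ a ≠ 3 ∧ a ≠ 4 ∧ a ≠ 5 := by omega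
    have hm : a % 4 = 0 ∨ a % 4 = 1 ∨ a % 4 = 2 ∨ a % 4 = 3 := by omega
    rcases hm with hm | hm | hm | hm <;> simp [innerPos, h0, h1, h2, h3, h4, h5, h6, hm, hr h6]
  · interval_cases a <;> simp [innerPos]

lemma innerPos_lineMap_cases {a b : ℕ} (hab : WheelArc a b) {s w : ℝ}
    (hw : 6 ≤ b → w = s * (b : ℝ)⁻¹) {p : ℝ × ℝ}
    (hp : AffineMap.lineMap (innerPos a) (innerPos b) s = p) :
    (a = 0 ∧ b = 1 ∧ p.1 = 1 - s ∧ p.2 = 1 - s) ∨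
    (a = 0 ∧ b = 2 ∧ p.1 = 1 + 3 * s ∧ p.2 = 1 - s) ∨
    (a = 0 ∧ b = 3 ∧ p.1 = 1 - s ∧ p.2 = 1 + 3 * s) ∨
    (a = 0 ∧ b = 4 ∧ p.1 = 1 - 5 * s ∧ p.2 = 1 - s) ∨
    (a = 0 ∧ b = 5 ∧ p.1 = 1 - s ∧ p.2 = 1 - 5 * s) ∨
    (a = 1 ∧ b = 2 ∧ p.1 = 4 * s ∧ p.2 = 0) ∨
    (a = 1 ∧ b = 3 ∧ p.1 = 0 ∧ p.2 = 4 * s) ∨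
    (a = 1 ∧ b = 4 ∧ p.1 = -4 * s ∧ p.2 = 0) ∨
    (a = 1 ∧ b = 5 ∧ p.1 = 0 ∧ p.2 = -4 * s) ∨
    (a = 4 ∧ 6 ≤ b ∧ b % 4 = 0 ∧ p.1 = -4 + 2 * s - w ∧ p.2 = -2 * s - w) ∨
    (a = 5 ∧ 6 ≤ b ∧ b % 4 = 0 ∧ p.1 = -2 * s - w ∧ p.2 = -4 + 2 * s - w) ∨
    (a = 5 ∧ 6 ≤ b ∧ b % 4 = 1 ∧ p.1 = 2 * s + w ∧ p.2 = -4 + 2 * s - w) ∨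
    (a = 2 ∧ 6 ≤ b ∧ b % 4 = 1 ∧ p.1 = 4 - 2 * s + w ∧ p.2 = -2 * s - w) ∨
    (a = 2 ∧ 6 ≤ b ∧ b % 4 = 2 ∧ p.1 = 4 - 2 * s + w ∧ p.2 = 2 * s + w) ∨
    (a = 3 ∧ 6 ≤ b ∧ b % 4 = 2 ∧ p.1 = 2 * s + w ∧ p.2 = 4 - 2 * s + w) ∨
    (a = 3 ∧ 6 ≤ b ∧ b % 4 = 3 ∧ p.1 = -2 * s - w ∧ p.2 = 4 - 2 * s + w) ∨
    (a = 4 ∧ 6 ≤ b ∧ b % 4 = 3 ∧ p.1 = -4 + 2 * s - w ∧ p.2 = 2 * s + w) := by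
  subst hp
  have key : ∀ c d : ℝ × ℝ, (AffineMap.lineMap c d s).1 = (1 - s) * c.1 + s * d.1 ∧
      (AffineMap.lineMap c d s).2 = (1 - s) * c.2 + s * d.2 := by
    intro c d
    simp only [AffineMap.lineMap_apply, vsub_eq_sub, vadd_eq_add, Prod.fst_add, Prod.snd_add,
      Prod.smul_fst, Prod.smul_snd, Prod.fst_sub, Prod.snd_sub, smul_eq_mul]
    constructor <;> ring
  rw [(key _ _).1, (key _ _).2]
  refine Or.imp ?_ (Or.imp ?_ (Or.imp ?_ (Or.imp ?_ (Or.imp ?_ (Or.imp ?_ (Or.imp ?_ (Or.imp ?_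
    (Or.imp ?_ (Or.imp ?_ (Or.imp ?_ (Or.imp ?_ (Or.imp ?_ (Or.imp ?_ (Or.imp ?_
      (Or.imp ?_ ?_))))))))))))))) hab.cases
  all_goals first
    | rintro ⟨rfl, rfl⟩
      refine ⟨rfl, rfl, ?_, ?_⟩ <;> norm_num [innerPos] <;> ring
    | rintro ⟨rfl, hb, hm⟩
      obtain ⟨h0, h1, h2, h3, h4, h5⟩ :
          b ≠ 0 ∧ b ≠ 1 ∧ b ≠ 2 ∧ b ≠ 3 ∧ b ≠ 4 ∧ b ≠ 5 := by omega
      refine ⟨rfl, hb, hm, ?_, ?_⟩ <;>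
        norm_num [innerPos, hm, h0, h1, h2, h3, h4, h5, hw hb] <;> ring

lemma exists_offset (b : ℕ) {s : ℝ} (hs : 0 ≤ s) :
    ∃ w, 0 ≤ w ∧ 6 * w ≤ s ∧ (6 ≤ b → w = s * (b : ℝ)⁻¹) := by
  by_cases hb : 6 ≤ b
  · have h6 : (6 : ℝ) ≤ b := by exact_mod_cast hb
    refine ⟨s * (b : ℝ)⁻¹, by positivity, ?_, fun _ => rfl⟩
    rw [← div_eq_mul_inv, mul_div_assoc', div_le_iff₀ (by linarith)]
    nlinarith
  · exact ⟨0, le_rfl, by linarith, fun h => absurd h hb⟩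

lemma arc_param_eq_zero {b d : ℕ} {s t w z : ℝ} (hw : w = s * (b : ℝ)⁻¹)
    (hz : z = t * (d : ℝ)⁻¹) (hst : s = t) (hwz : w = z) (hne : b ≠ d) : s = 0 := by
  have h : s * ((b : ℝ)⁻¹ - (d : ℝ)⁻¹) = 0 := by
    rw [mul_sub, ← hw, hwz, hz, hst, sub_self]
  refine (mul_eq_zero.1 h).resolve_right fun h' => hne ?_
  exact_mod_cast inv_injective (sub_eq_zero.1 h')

lemma outerPos_injective : Function.Injective outerPos := by
  intro a b hab
  obtain ⟨r, hr0, hr1, hr⟩ := exists_offset a zero_le_one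
  obtain ⟨z, hz0, hz1, hz⟩ := exists_offset b zero_le_one
  rw [one_mul] at hr hz
  have hA := outerPos_cases a rfl hr
  have hB := outerPos_cases b hab.symm hz
  generalize outerPos a = p at hA hB
  clear hab
  rcases hA with ⟨ha, hx, hy⟩ | ⟨ha, hx, hy⟩ | ⟨ha, hx, hy⟩ | ⟨ha, hx, hy⟩ | ⟨ha, hx, hy⟩ |
    ⟨ha, hx, hy⟩ | ⟨ha, hm, hx, hy⟩ | ⟨ha, hm, hx, hy⟩ | ⟨ha, hm, hx, hy⟩ | ⟨ha, hm, hx, hy⟩ <;>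
    rcases hB with ⟨hb, hx', hy'⟩ | ⟨hb, hx', hy'⟩ | ⟨hb, hx', hy'⟩ | ⟨hb, hx', hy'⟩ |
      ⟨hb, hx', hy'⟩ | ⟨hb, hx', hy'⟩ | ⟨hb, hm', hx', hy'⟩ | ⟨hb, hm', hx', hy'⟩ |
      ⟨hb, hm', hx', hy'⟩ | ⟨hb, hm', hx', hy'⟩ <;>
    first
    | exact ha.trans hb.symm
    | (have hX := hx.symm.trans hx'
       have hY := hy.symm.trans hy'
       clear hx hy hx' hy'
       first
       | (exfalso; linarith only [hX, hY, hr0, hr1, hz0, hz1])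
       | exact_mod_cast inv_injective (((hr ha).symm.trans
           (by linarith only [hX, hY] : r = z)).trans (hz hb)))

lemma innerPos_injective : Function.Injective innerPos := by
  intro a b hab
  obtain ⟨r, hr0, hr1, hr⟩ := exists_offset a zero_le_one
  obtain ⟨z, hz0, hz1, hz⟩ := exists_offset b zero_le_one
  rw [one_mul] at hr hz
  have hA := innerPos_cases a rfl hr
  have hB := innerPos_cases b hab.symm hz
  generalize innerPos a = p at hA hB
  clear hab
  rcases hA with ⟨ha, hx, hy⟩ | ⟨ha, hx, hy⟩ | ⟨ha, hx, hy⟩ | ⟨ha, hx, hy⟩ | ⟨ha, hx, hy⟩ |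
    ⟨ha, hx, hy⟩ | ⟨ha, hm, hx, hy⟩ | ⟨ha, hm, hx, hy⟩ | ⟨ha, hm, hx, hy⟩ | ⟨ha, hm, hx, hy⟩ <;>
    rcases hB with ⟨hb, hx', hy'⟩ | ⟨hb, hx', hy'⟩ | ⟨hb, hx', hy'⟩ | ⟨hb, hx', hy'⟩ |
      ⟨hb, hx', hy'⟩ | ⟨hb, hx', hy'⟩ | ⟨hb, hm', hx', hy'⟩ | ⟨hb, hm', hx', hy'⟩ |
      ⟨hb, hm', hx', hy'⟩ | ⟨hb, hm', hx', hy'⟩ <;>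
    first
    | exact ha.trans hb.symm
    | (have hX := hx.symm.trans hx'
       have hY := hy.symm.trans hy'
       clear hx hy hx' hy'
       first
       | (exfalso; linarith only [hX, hY, hr0, hr1, hz0, hz1])
       | exact_mod_cast inv_injective (((hr ha).symm.trans
           (by linarith only [hX, hY] : r = z)).trans (hz hb)))

lemma outerPos_sub {b : ℕ} (hb : 6 ≤ b) (hm : b % 4 = 0) :
    (outerPos 1).1 - (outerPos 0).1 = 0 ∧ (outerPos 1).2 - (outerPos 0).2 = -3 ∧
      (outerPos b).1 - (outerPos 4).1 = -1 := by
  obtain ⟨h0, h1, h2, h3, h4, h5⟩ :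
      b ≠ 0 ∧ b ≠ 1 ∧ b ≠ 2 ∧ b ≠ 3 ∧ b ≠ 4 ∧ b ≠ 5 := by omega
  norm_num [outerPos, hm, h0, h1, h2, h3, h4, h5]

set_option maxHeartbeats 8000000 in
lemma outerPos_meetsProperly {a b c d : ℕ} (hab : WheelArc a b) (hcd : WheelArc c d)
    (hne : ¬ (a = c ∧ b = d)) :
    MeetsProperly (fun _ => (a = 0 ∧ b = 1) ∨ (c = 0 ∧ d = 1))
      (outerPos a) (outerPos b) (outerPos c) (outerPos d) := by
  intro s ⟨hs0, hs1⟩ t ⟨ht0, ht1⟩ hst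
  obtain ⟨w, hw0, hw1, hw⟩ := exists_offset b hs0
  obtain ⟨z, hz0, hz1, hz⟩ := exists_offset d ht0
  have hA := outerPos_lineMap_cases hab hw rfl
  have hB := outerPos_lineMap_cases hcd hz hst.symm
  generalize AffineMap.lineMap (outerPos a) (outerPos b) s = p at hA hB
  clear hst hab hcd
  rcases hA with ⟨ha, hb, hx, hy⟩ | ⟨ha, hb, hx, hy⟩ | ⟨ha, hb, hx, hy⟩ | ⟨ha, hb, hx, hy⟩ |
    ⟨ha, hb, hx, hy⟩ | ⟨ha, hb, hx, hy⟩ | ⟨ha, hb, hx, hy⟩ | ⟨ha, hb, hx, hy⟩ | ⟨ha, hb, hx, hy⟩ |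
    ⟨ha, hb, hm, hx, hy⟩ | ⟨ha, hb, hm, hx, hy⟩ | ⟨ha, hb, hm, hx, hy⟩ | ⟨ha, hb, hm, hx, hy⟩ |
    ⟨ha, hb, hm, hx, hy⟩ | ⟨ha, hb, hm, hx, hy⟩ | ⟨ha, hb, hm, hx, hy⟩ | ⟨ha, hb, hm, hx, hy⟩ <;>
    rcases hB with ⟨hc, hd, hx', hy'⟩ | ⟨hc, hd, hx', hy'⟩ | ⟨hc, hd, hx', hy'⟩ |
      ⟨hc, hd, hx', hy'⟩ | ⟨hc, hd, hx', hy'⟩ | ⟨hc, hd, hx', hy'⟩ | ⟨hc, hd, hx', hy'⟩ |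
      ⟨hc, hd, hx', hy'⟩ | ⟨hc, hd, hx', hy'⟩ | ⟨hc, hd, hm', hx', hy'⟩ |
      ⟨hc, hd, hm', hx', hy'⟩ | ⟨hc, hd, hm', hx', hy'⟩ | ⟨hc, hd, hm', hx', hy'⟩ |
      ⟨hc, hd, hm', hx', hy'⟩ | ⟨hc, hd, hm', hx', hy'⟩ | ⟨hc, hd, hm', hx', hy'⟩ |
      ⟨hc, hd, hm', hx', hy'⟩ <;>
    first
    | (exfalso; exact hne (And.intro (ha.trans hc.symm) (hb.trans hd.symm)))
    | (have hX := hx.symm.trans hx'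
       have hY := hy.symm.trans hy'
       first
       | (exfalso; linarith only [hX, hY, hs0, hs1, ht0, ht1, hw0, hw1, hz0, hz1])
       | exact .inl ⟨.inl (by linarith only [hX, hY, hs0, hs1, ht0, ht1, hw0, hw1, hz0, hz1]),
           .inl (by linarith only [hX, hY, hs0, hs1, ht0, ht1, hw0, hw1, hz0, hz1])⟩
       | exact .inl ⟨.inr (by linarith only [hX, hY, hs0, hs1, ht0, ht1, hw0, hw1, hz0, hz1]),
           .inr (by linarith only [hX, hY, hs0, hs1, ht0, ht1, hw0, hw1, hz0, hz1])⟩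
       | exact .inl ⟨.inl (by linarith only [hX, hY, hs0, hs1, ht0, ht1, hw0, hw1, hz0, hz1]),
           .inr (by linarith only [hX, hY, hs0, hs1, ht0, ht1, hw0, hw1, hz0, hz1])⟩
       | exact .inl ⟨.inr (by linarith only [hX, hY, hs0, hs1, ht0, ht1, hw0, hw1, hz0, hz1]),
           .inl (by linarith only [hX, hY, hs0, hs1, ht0, ht1, hw0, hw1, hz0, hz1])⟩
       | (have hst : s = t := by linarith only [hX, hY]
          have h0 : s = 0 := arc_param_eq_zero (hw hb) (hz hd) hst (by linarith only [hX, hY])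
            fun h => hne ⟨ha.trans hc.symm, h⟩
          exact .inl ⟨.inl h0, .inl (hst ▸ h0)⟩)
       | (refine .inr ⟨⟨by linarith, by linarith⟩, ⟨by linarith, by linarith⟩, .inl ⟨ha, hb⟩, ?_⟩
          obtain ⟨e1, e2, e3⟩ := outerPos_sub hd hm'
          rw [ha, hb, hc, e1, e2, e3]
          norm_num)
       | (refine .inr ⟨⟨by linarith, by linarith⟩, ⟨by linarith, by linarith⟩, .inr ⟨hc, hd⟩, ?_⟩
          obtain ⟨e1, e2, e3⟩ := outerPos_sub hb hm
          rw [ha, hc, hd, e1, e2, e3]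
          norm_num))
set_option maxHeartbeats 8000000 in
lemma innerPos_meetsProperly {a b c d : ℕ} (hab : WheelArc a b) (hcd : WheelArc c d)
    (hne : ¬ (a = c ∧ b = d)) :
    MeetsProperly (fun p =>
        (p = (0, 4 / 5) ∧ (a = 0 ∧ b = 4 ∨ a = 1 ∧ b = 3) ∧ (c = 0 ∧ d = 4 ∨ c = 1 ∧ d = 3)) ∨
        (p = (4 / 5, 0) ∧ (a = 0 ∧ b = 5 ∨ a = 1 ∧ b = 2) ∧ (c = 0 ∧ d = 5 ∨ c = 1 ∧ d = 2)))
      (innerPos a) (innerPos b) (innerPos c) (innerPos d) := by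
  intro s ⟨hs0, hs1⟩ t ⟨ht0, ht1⟩ hst
  obtain ⟨w, hw0, hw1, hw⟩ := exists_offset b hs0
  obtain ⟨z, hz0, hz1, hz⟩ := exists_offset d ht0
  have hA := innerPos_lineMap_cases hab hw rfl
  have hB := innerPos_lineMap_cases hcd hz hst.symm
  generalize AffineMap.lineMap (innerPos a) (innerPos b) s = p at hA hB
  clear hst hab hcd
  rcases hA with ⟨ha, hb, hx, hy⟩ | ⟨ha, hb, hx, hy⟩ | ⟨ha, hb, hx, hy⟩ | ⟨ha, hb, hx, hy⟩ |
    ⟨ha, hb, hx, hy⟩ | ⟨ha, hb, hx, hy⟩ | ⟨ha, hb, hx, hy⟩ | ⟨ha, hb, hx, hy⟩ | ⟨ha, hb, hx, hy⟩ |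
    ⟨ha, hb, hm, hx, hy⟩ | ⟨ha, hb, hm, hx, hy⟩ | ⟨ha, hb, hm, hx, hy⟩ | ⟨ha, hb, hm, hx, hy⟩ |
    ⟨ha, hb, hm, hx, hy⟩ | ⟨ha, hb, hm, hx, hy⟩ | ⟨ha, hb, hm, hx, hy⟩ | ⟨ha, hb, hm, hx, hy⟩ <;>
    rcases hB with ⟨hc, hd, hx', hy'⟩ | ⟨hc, hd, hx', hy'⟩ | ⟨hc, hd, hx', hy'⟩ |
      ⟨hc, hd, hx', hy'⟩ | ⟨hc, hd, hx', hy'⟩ | ⟨hc, hd, hx', hy'⟩ | ⟨hc, hd, hx', hy'⟩ |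
      ⟨hc, hd, hx', hy'⟩ | ⟨hc, hd, hx', hy'⟩ | ⟨hc, hd, hm', hx', hy'⟩ |
      ⟨hc, hd, hm', hx', hy'⟩ | ⟨hc, hd, hm', hx', hy'⟩ | ⟨hc, hd, hm', hx', hy'⟩ |
      ⟨hc, hd, hm', hx', hy'⟩ | ⟨hc, hd, hm', hx', hy'⟩ | ⟨hc, hd, hm', hx', hy'⟩ |
      ⟨hc, hd, hm', hx', hy'⟩ <;>
    first
    | (exfalso; exact hne (And.intro (ha.trans hc.symm) (hb.trans hd.symm)))
    | (have hX := hx.symm.trans hx'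
       have hY := hy.symm.trans hy'
       first
       | (exfalso; linarith only [hX, hY, hs0, hs1, ht0, ht1, hw0, hw1, hz0, hz1])
       | exact .inl ⟨.inl (by linarith only [hX, hY, hs0, hs1, ht0, ht1, hw0, hw1, hz0, hz1]),
           .inl (by linarith only [hX, hY, hs0, hs1, ht0, ht1, hw0, hw1, hz0, hz1])⟩
       | exact .inl ⟨.inr (by linarith only [hX, hY, hs0, hs1, ht0, ht1, hw0, hw1, hz0, hz1]),
           .inr (by linarith only [hX, hY, hs0, hs1, ht0, ht1, hw0, hw1, hz0, hz1])⟩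
       | exact .inl ⟨.inl (by linarith only [hX, hY, hs0, hs1, ht0, ht1, hw0, hw1, hz0, hz1]),
           .inr (by linarith only [hX, hY, hs0, hs1, ht0, ht1, hw0, hw1, hz0, hz1])⟩
       | exact .inl ⟨.inr (by linarith only [hX, hY, hs0, hs1, ht0, ht1, hw0, hw1, hz0, hz1]),
           .inl (by linarith only [hX, hY, hs0, hs1, ht0, ht1, hw0, hw1, hz0, hz1])⟩
       | (have hst : s = t := by linarith only [hX, hY]
          have h0 : s = 0 := arc_param_eq_zero (hw hb) (hz hd) hst (by linarith only [hX, hY])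
            fun h => hne ⟨ha.trans hc.symm, h⟩
          exact .inl ⟨.inl h0, .inl (hst ▸ h0)⟩)
       | (refine .inr ⟨⟨by linarith, by linarith⟩, ⟨by linarith, by linarith⟩,
            .inl ⟨Prod.ext (by linarith) (by linarith), by omega, by omega⟩, ?_⟩
          norm_num [ha, hb, hc, hd, innerPos])
       | (refine .inr ⟨⟨by linarith, by linarith⟩, ⟨by linarith, by linarith⟩,
            .inr ⟨Prod.ext (by linarith) (by linarith), by omega, by omega⟩, ?_⟩
          norm_num [ha, hb, hc, hd, innerPos]))

lemma WheelArc.lt {a b : ℕ} (h : WheelArc a b) : a < b := by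
  unfold WheelArc at h
  omega

/-- The graph on `0, …, n - 1` with adjacent hubs `0` and `1`, both joined to `2, 3, 4, 5`, in which
every further vertex `b` is joined to two of `2, 3, 4, 5`, cyclically consecutive in the order
`2, 3, 4, 5` and depending on `b` modulo `4`. -/
def bundleWheel (n : ℕ) : SimpleGraph (Fin n) :=
  SimpleGraph.fromRel fun a b => WheelArc a b

namespace bundleWheel

variable {n : ℕ}

lemma adj_iff (a b : Fin n) : (bundleWheel n).Adj a b ↔ WheelArc a b ∨ WheelArc b a := by
  refine ⟨fun h => h.2, fun h => ⟨fun hab => ?_, h⟩⟩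
  subst hab
  exact h.elim (fun h => h.lt.false) fun h => h.lt.false

lemma exists_adj (hn : 6 ≤ n) (a : Fin n) : ∃ b, (bundleWheel n).Adj a b := by
  obtain ⟨a, ha⟩ := a
  simp only [adj_iff]
  by_cases h1 : a ≤ 1
  · exact ⟨⟨2, by omega⟩, .inl (.inr (.inl ⟨h1, by simp⟩))⟩
  by_cases h5 : a ≤ 5
  · exact ⟨⟨0, by omega⟩, .inr (.inr (.inl ⟨by simp, by omega, h5⟩))⟩
  · refine ⟨⟨2 + (a + 2) % 4, by omega⟩, .inr (.inr (.inr ?_))⟩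
    simp only
    omega

lemma map_val_injective : Function.Injective (Sym2.map (Fin.val : Fin n → ℕ)) :=
  Sym2.map.injective Fin.val_injective

lemma not_and_eq {a b c d : Fin n} (h : s(a, b) ≠ s(c, d)) :
    ¬ ((a : ℕ) = c ∧ (b : ℕ) = d) := fun h' => h (by rw [Fin.ext h'.1, Fin.ext h'.2])

lemma exists_isSkewness (hn : 6 ≤ n) : ∃ Γ : Drawing (bundleWheel n), Γ.IsSkewness 1 := by
  obtain ⟨Γ, hΓ⟩ := Drawing.exists_of_meetsProperly (fun a b : Fin n => WheelArc a b) adj_iff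
    (fun a => outerPos a) (outerPos_injective.comp Fin.val_injective) (exists_adj hn)
    (fun e f _ => e.map Fin.val = s(0, 1) ∨ f.map Fin.val = s(0, 1))
    (fun e f g p hef heg hfg h₁ h₂ h₃ => by
      have hef := map_val_injective.ne hef
      have heg := map_val_injective.ne heg
      have hfg := map_val_injective.ne hfg
      grind)
    fun a b c d hab hcd hne s hs t ht hst => by
      refine (outerPos_meetsProperly hab hcd (not_and_eq hne) s hs t ht hst).imp_right
        fun ⟨h₁, h₂, h₃, h₄⟩ => ⟨h₁, h₂, h₃.imp ?_ ?_, h₄⟩ <;>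
      · rintro ⟨h, h'⟩
        simp [h, h']
  refine ⟨Γ, {s(⟨0, by omega⟩, ⟨1, by omega⟩)}, by simp, ?_⟩
  rintro p ⟨e, f, h⟩
  have key : ∀ g : Sym2 (Fin n), g.map Fin.val = s(0, 1) → g = s(⟨0, by omega⟩, ⟨1, by omega⟩) :=
    fun g hg => map_val_injective (by simpa using hg)
  rcases hΓ e f p h with h' | h'
  · exact ⟨e, by simpa using key e h', f, h⟩
  · exact ⟨f, by simpa using key f h', e, h.2.1, h.1, h.2.2.1.symm, h.2.2.2.2.1, h.2.2.2.1,
      h.2.2.2.2.2⟩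

lemma crNum_le (hn : 6 ≤ n) : crNum (bundleWheel n) ≤ 3 := by
  obtain ⟨Γ, hΓ⟩ := Drawing.exists_of_meetsProperly (fun a b : Fin n => WheelArc a b) adj_iff
    (fun a => innerPos a) (innerPos_injective.comp Fin.val_injective) (exists_adj hn)
    (fun e f p =>
      (p = (0, 4 / 5) ∧ e.map Fin.val ∈ ({s(0, 4), s(1, 3)} : Set (Sym2 ℕ)) ∧
        f.map Fin.val ∈ ({s(0, 4), s(1, 3)} : Set (Sym2 ℕ))) ∨
      (p = (4 / 5, 0) ∧ e.map Fin.val ∈ ({s(0, 5), s(1, 2)} : Set (Sym2 ℕ)) ∧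
        f.map Fin.val ∈ ({s(0, 5), s(1, 2)} : Set (Sym2 ℕ))))
    (fun e f g p hef heg hfg h₁ h₂ _ => by
      have hef := map_val_injective.ne hef
      have heg := map_val_injective.ne heg
      have hfg := map_val_injective.ne hfg
      simp only [mem_insert_iff, mem_singleton_iff] at h₁ h₂
      have hp : ((0, 4 / 5) : ℝ × ℝ) ≠ (4 / 5, 0) := by simp
      grind)
    fun a b c d hab hcd hne s hs t ht hst => by
      refine (innerPos_meetsProperly hab hcd (not_and_eq hne) s hs t ht hst).imp_right
        fun ⟨h₁, h₂, h₃, h₄⟩ => ⟨h₁, h₂, h₃.imp ?_ ?_, h₄⟩ <;>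
      · rintro ⟨h, h', h''⟩
        refine ⟨h, h'.imp ?_ ?_, h''.imp ?_ ?_⟩ <;>
        · rintro ⟨h, h'⟩
          simp [h, h']
  calc crNum (bundleWheel n) ≤ Γ.crossings := Nat.sInf_le ⟨Γ, rfl⟩
    _ ≤ ({(0, 4 / 5), (4 / 5, 0)} : Set (ℝ × ℝ)).ncard :=
      ncard_le_ncard (fun p ⟨e, f, h⟩ => (hΓ e f p h).imp And.left And.left) (toFinite _)
    _ = 2 := ncard_pair (by simp)
    _ ≤ 3 := by norm_num

lemma isDoubleWheel {k : ℕ} (hk : 4 * k + 10 ≤ n) :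
    IsDoubleWheel (bundleWheel n) ⟨0, by omega⟩ ⟨1, by omega⟩
      (fun j => ⟨2 + (j + 2) % 4, by omega⟩) fun j => ⟨6 + 4 * k + (j + 2) % 4, by omega⟩ where
  adj_hubs := (adj_iff _ _).2 (.inl (.inl ⟨rfl, rfl⟩))
  adj_left j := (adj_iff _ _).2 (.inl (.inr (.inl (by simp only; omega))))
  adj_right j := (adj_iff _ _).2 (.inl (.inr (.inl (by simp only; omega))))
  adj_out j := (adj_iff _ _).2 (.inl (.inr (.inr (by simp only; omega))))
  adj_in j := (adj_iff _ _).2 (.inr (.inr (.inr (by simp only [Fin.val_add]; omega))))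
  x_inj i j h := by
    simp only [Fin.mk.injEq] at h
    omega
  left_ne j h := by
    simp only [Fin.mk.injEq] at h
    omega
  right_ne j h := by
    simp only [Fin.mk.injEq] at h
    omega
  x_ne i j h := by
    simp only [Fin.mk.injEq] at h
    omega

lemma le_crNumRestricted {ℓ : ℕ} (hℓ : 2 ≤ ℓ) (hn : 4 * ℓ + 6 ≤ n) :
    ℓ ≤ crNumRestricted (bundleWheel n) (fun Γ => Γ.IsSkewness 1) := by
  obtain ⟨Γ₀, hΓ₀⟩ := exists_isSkewness (n := n) (by omega)
  obtain ⟨Γ, hΓ, h⟩ := Nat.sInf_mem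
    (s := {m | ∃ Γ : Drawing (bundleWheel n), Γ.IsSkewness 1 ∧ Γ.crossings = m})
    ⟨_, Γ₀, hΓ₀, rfl⟩
  rw [crNumRestricted, ← h]
  have hk : ∀ k : Fin ℓ, 4 * (k : ℕ) + 10 ≤ n := fun k => by omega
  refine Γ.le_crossings_of_isDoubleWheel hΓ hℓ
    (u := ⟨0, by omega⟩) (v := ⟨1, by omega⟩) (x := fun j => ⟨2 + (j + 2) % 4, by omega⟩)
    (q := fun k j => ⟨6 + 4 * k + (j + 2) % 4, by have := hk k; omega⟩)
    (fun k => isDoubleWheel (hk k))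
    fun k k' j j' hq => ?_
  simp only [Fin.mk.injEq] at hq
  omega

end bundleWheel

/-- For every `ℓ ≥ 3` there exists a skewness-1 simple graph
on exactly `n = 11ℓ - 4` vertices with `cr_{skew-1}(G) ≥ ℓ` and `cr(G) ≤ 3`;
moreover the skewness-1 crossing ratio is `Θ(n)`. -/
theorem skewness_one_crossing_ratio (ℓ : ℕ) (hℓ : 3 ≤ ℓ) :
    (∃ G : SimpleGraph (Fin (11 * ℓ - 4)),
      (∃ Γ : Drawing G, Γ.IsSkewness 1) ∧
      ℓ ≤ crNumRestricted G (fun Γ => Γ.IsSkewness 1) ∧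
      crNum G ≤ 3) ∧
    -- the skewness-1 crossing ratio is O(n):
    (∃ c : ℝ, 0 < c ∧ ∀ (n : ℕ) (G : SimpleGraph (Fin n)),
      (∃ Γ : Drawing G, Γ.IsSkewness 1) → 1 ≤ crNum G →
      (crNumRestricted G (fun Γ => Γ.IsSkewness 1) : ℝ) ≤ c * n * crNum G) ∧
    -- the skewness-1 crossing ratio is Ω(n):
    (∃ c : ℝ, 0 < c ∧ ∀ N : ℕ, ∃ n, N ≤ n ∧ ∃ G : SimpleGraph (Fin n),
      (∃ Γ : Drawing G, Γ.IsSkewness 1) ∧ 1 ≤ crNum G ∧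
      c * n * crNum G ≤ (crNumRestricted G (fun Γ => Γ.IsSkewness 1) : ℝ)) := by
  refine ⟨⟨bundleWheel _, bundleWheel.exists_isSkewness (by omega),
    bundleWheel.le_crNumRestricted (by omega) (by omega), bundleWheel.crNum_le (by omega)⟩,
    ⟨64, by norm_num, fun n G hG hcr => ?_⟩, 1 / 33, by norm_num, fun N => ?_⟩
  · have h := crNumRestricted_isSkewness_one_le hG hcr
    rw [Fintype.card_fin] at h
    exact_mod_cast h.trans (Nat.le_mul_of_pos_right _ hcr)
  · obtain ⟨m, hm, hN⟩ : ∃ m, 3 ≤ m ∧ N ≤ m := ⟨max N 3, le_max_right _ _, le_max_left _ _⟩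
    have hskew := bundleWheel.exists_isSkewness (n := 11 * m - 4) (by omega)
    have hle := bundleWheel.le_crNumRestricted (n := 11 * m - 4) (ℓ := m) (by omega) (by omega)
    refine ⟨11 * m - 4, by omega, bundleWheel _, hskew, one_le_crNum (by omega) hskew hle, ?_⟩
    have h₁ : ((11 * m - 4 : ℕ) : ℝ) ≤ 11 * m := by exact_mod_cast Nat.sub_le _ _
    have h₂ : (crNum (bundleWheel (11 * m - 4)) : ℝ) ≤ 3 := by
      exact_mod_cast bundleWheel.crNum_le (by omega)
    calc (1 / 33 * (11 * m - 4 : ℕ) * crNum (bundleWheel (11 * m - 4)) : ℝ)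
        ≤ 1 / 33 * (11 * m) * 3 := by gcongr
      _ = m := by ring
      _ ≤ _ := by exact_mod_cast hle
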